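/- (Heilbronn) If there exists a positive integer h₀ and infinitely many squarefree integers d < 0 such that the class number of the imaginary quadratic field ℚ(√d) equals h₀, then the generalized Riemann hypothesis holds for all Dirichlet L-series with quadratic characters: for every Dirichlet character χ (of any modulus) satisfying χ² = χ₀ (the principal character), every zero s of the Dirichlet L-function L(s,χ) with 0 < Re s < 1 satisfies Re s = 1/2. -/

import Mathlib

open Complex
namespace Heil

open MeasureTheory Filter Asymptotics Topology

/-- measurability of the remainder -/
lemma locInt_E (a : ℕ → ℂ) (κ : ℂ) :
    LocallyIntegrableOn (fun t : ℝ ↦ (∑ k ∈ Finset.Icc 1 ⌊t⌋₊, a k) - κ * t) (Set.Ici 0) := by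
  refine .sub ?_ <| ContinuousOn.locallyIntegrableOn (by fun_prop) measurableSet_Ici
  simpa using locallyIntegrableOn_mul_sum_Icc a (m := 1) (a := 0) le_rfl (locallyIntegrableOn_const 1)

lemma E_integrable (a : ℕ → ℂ) (κ : ℂ) (C : ℝ)
    (hE : ∀ x : ℝ, 1 ≤ x → ‖(∑ k ∈ Finset.Icc 1 ⌊x⌋₊, a k) - κ * x‖ ≤ C * √x)
    (s : ℂ) (hs : 1 / 2 < s.re) :
    IntegrableOn (fun t : ℝ ↦ ((∑ k ∈ Finset.Icc 1 ⌊t⌋₊, a k) - κ * t) * (t : ℂ) ^ (-(s + 1)))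
      (Set.Ioi 1) := by
  have h0 : LocallyIntegrableOn (fun t : ℝ ↦ ((∑ k ∈ Finset.Icc 1 ⌊t⌋₊, a k) - κ * t) *
      (t : ℂ) ^ (-(s + 1))) (Set.Ici 1) := by
    refine ((locInt_E a κ).mono_set (Set.Ici_subset_Ici.mpr zero_le_one)).mul_continuousOn ?_ isLocallyClosed_Ici
    exact fun t ht ↦ (continuousAt_ofReal_cpow_const _ _ <|
      Or.inr (zero_lt_one.trans_le ht).ne').continuousWithinAt
  refine IntegrableOn.mono_set ?_ Set.Ioi_subset_Ici_self
  refine h0.integrableOn_of_isBigO_atTop (g := fun t ↦ t ^ (-(s.re + 1 / 2))) ?_ ?_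
  · refine isBigO_iff.mpr ⟨C, ?_⟩
    filter_upwards [eventually_ge_atTop 1] with t ht
    have ht0 : 0 < t := by linarith
    rw [norm_mul, Complex.norm_cpow_eq_rpow_re_of_pos ht0, Real.norm_of_nonneg (by positivity)]
    calc _ ≤ (C * √t) * t ^ (-(s + 1)).re := by
            gcongr; exact hE t ht
      _ = _ := by
        rw [mul_assoc, Real.sqrt_eq_rpow, ← Real.rpow_add ht0]
        congr 2; simp; ring
  · rw [integrableAtFilter_rpow_atTop_iff]; linarith

lemma analytic_E (a : ℕ → ℂ) (κ : ℂ) (C : ℝ)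
    (hE : ∀ x : ℝ, 1 ≤ x → ‖(∑ k ∈ Finset.Icc 1 ⌊x⌋₊, a k) - κ * x‖ ≤ C * √x)
    (s : ℂ) (hs : 1 / 2 < s.re) :
    DifferentiableAt ℂ (fun s : ℂ ↦ ∫ t in Set.Ioi (1 : ℝ),
      ((∑ k ∈ Finset.Icc 1 ⌊t⌋₊, a k) - κ * t) * (t : ℂ) ^ (-(s + 1))) s := by
  set E : ℝ → ℂ := fun t ↦ (∑ k ∈ Finset.Icc 1 ⌊t⌋₊, a k) - κ * t with hEdef
  let f : ℝ → ℂ := Set.indicator (Set.Ioi 1) E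
  have key : (fun s : ℂ ↦ ∫ t in Set.Ioi (1 : ℝ), E t * (t : ℂ) ^ (-(s + 1))) =
      fun s ↦ mellin f (-s) := by
    ext s
    rw [mellin, ← integral_indicator measurableSet_Ioi, ← integral_indicator measurableSet_Ioi]
    congr 1
    ext t
    simp only [Set.indicator, Set.mem_Ioi, f, smul_eq_mul]
    split_ifs with h1 h2
    · rw [mul_comm]; congr 2; ring
    · linarith
    · simp
    · rfl
  rw [key]
  have : DifferentiableAt ℂ (mellin f) (-s) := by
    refine mellin_differentiableAt_of_isBigO_rpow (a := -(1 / 2)) (b := - s.re - 1) ?_ ?_ ?_ ?_ ?_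
    · have h1 := (locInt_E a κ)
      have : LocallyIntegrableOn f (Set.Ici 0) := by
        rw [locallyIntegrableOn_iff isLocallyClosed_Ici] at h1 ⊢
        intro K hK hc
        exact (h1 K hK hc).indicator measurableSet_Ioi
      exact this.mono_set Set.Ioi_subset_Ici_self
    · refine isBigO_iff.mpr ⟨C, ?_⟩
      filter_upwards [eventually_gt_atTop 1] with t ht
      have ht0 : 0 < t := by linarith
      simp only [f, Set.indicator, Set.mem_Ioi, ht, if_true]
      rw [Real.norm_of_nonneg (by positivity)]
      have := hE t ht.le
      rw [Real.sqrt_eq_rpow] at this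
      simpa using this
    · simpa using hs
    · refine isBigO_iff.mpr ⟨0, ?_⟩
      have : Set.Iio (1 : ℝ) ∈ 𝓝[>] (0 : ℝ) := mem_nhdsWithin_of_mem_nhds (Iio_mem_nhds one_pos)
      filter_upwards [this] with t ht
      have : ¬ (1 < t) := not_lt.mpr (le_of_lt ht)
      simp [f, Set.indicator, this]
    · simp
  exact this.comp s (differentiableAt_id.neg)

lemma continuation (a : ℕ → ℂ) (κ : ℂ) (C : ℝ)
    (hE : ∀ x : ℝ, 1 ≤ x → ‖(∑ k ∈ Finset.Icc 1 ⌊x⌋₊, a k) - κ * x‖ ≤ C * √x)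
    (hsum : ∀ s : ℂ, 1 < s.re → LSeriesSummable a s) (G : ℂ → ℂ)
    (hG : ∀ s, s ≠ 1 → DifferentiableAt ℂ G s) (hGa : ∀ s : ℂ, 1 < s.re → G s = LSeries a s)
    (ρ : ℂ) (h1 : 1 / 2 < ρ.re) (h2 : ρ.re < 1) :
    G ρ = κ * ρ / (ρ - 1) + ρ * ∫ t in Set.Ioi (1 : ℝ),
      ((∑ k ∈ Finset.Icc 1 ⌊t⌋₊, a k) - κ * t) * (t : ℂ) ^ (-(ρ + 1)) := by
  set H : ℂ → ℂ := fun s ↦ κ * s / (s - 1) + s * ∫ t in Set.Ioi (1 : ℝ),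
      ((∑ k ∈ Finset.Icc 1 ⌊t⌋₊, a k) - κ * t) * (t : ℂ) ^ (-(s + 1)) with hH
  have hC : 0 ≤ C := by
    have := (norm_nonneg _).trans (hE 1 le_rfl)
    simpa using this
  have hHd : ∀ s : ℂ, 1 / 2 < s.re → s ≠ 1 → DifferentiableAt ℂ H s := by
    intro s hs hs1
    have := analytic_E a κ C hE s hs
    have h3 : s - 1 ≠ 0 := sub_ne_zero.mpr hs1
    refine DifferentiableAt.add ?_ (differentiableAt_id.mul this)
    exact (differentiableAt_id.const_mul κ).div (differentiableAt_id.sub_const 1) h3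
  -- agreement for re > 1
  have hagree : ∀ s : ℂ, 1 < s.re → G s = H s := by
    intro s hs
    have hs0 : s ≠ 0 := by rintro rfl; simp at hs; linarith
    have hs1 : s - 1 ≠ 0 := by
      intro h; rw [sub_eq_zero] at h; rw [h] at hs; simp at hs
    rw [hGa s hs, LSeries_eq_mul_integral a zero_le_one hs (hsum s hs)]
    · rw [hH]
      have hi := E_integrable a κ C hE s (by linarith)
      have hi2 : IntegrableOn (fun t : ℝ ↦ κ * (t : ℂ) ^ (-s)) (Set.Ioi 1) :=
        (integrableOn_Ioi_cpow_of_lt (by simpa using hs) zero_lt_one).const_mul _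
      have : ∫ t in Set.Ioi (1 : ℝ), (∑ k ∈ Finset.Icc 1 ⌊t⌋₊, a k) * (t : ℂ) ^ (-(s + 1)) =
          (∫ t in Set.Ioi (1 : ℝ),
      ((∑ k ∈ Finset.Icc 1 ⌊t⌋₊, a k) - κ * t) * (t : ℂ) ^ (-(s + 1))) +
          ∫ t in Set.Ioi (1 : ℝ), κ * (t : ℂ) ^ (-s) := by
        rw [← integral_add hi hi2]
        refine setIntegral_congr_fun measurableSet_Ioi fun t ht ↦ ?_
        have ht0 : (t : ℂ) ≠ 0 := by
          have : (0 : ℝ) < t := zero_lt_one.trans ht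
          exact_mod_cast this.ne'
        have : (t : ℂ) ^ (-s) = t * (t : ℂ) ^ (-(s + 1)) := by
          rw [show -s = 1 + (-(s + 1)) by ring, cpow_add _ _ ht0, cpow_one]
        rw [this]; ring
      rw [this, integral_const_mul, integral_Ioi_cpow_of_lt (by simpa using hs) zero_lt_one]
      have h4 : -s + 1 ≠ 0 := by intro h; apply hs1; linear_combination -h
      simp only [ofReal_one, one_cpow]
      field_simp
      ring
    · refine isBigO_iff.mpr ⟨C + ‖κ‖, ?_⟩
      filter_upwards [eventually_ge_atTop 1] with n hn
      have hn' : (1 : ℝ) ≤ n := by exact_mod_cast hn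
      have := hE n hn'
      rw [Nat.floor_natCast] at this
      have h5 : √(n : ℝ) ≤ n := by
        rw [Real.sqrt_le_left (by positivity)]; nlinarith
      rw [Real.rpow_one, Real.norm_of_nonneg (by positivity)]
      calc _ = ‖((∑ k ∈ Finset.Icc 1 n, a k) - κ * (n : ℝ)) + κ * (n : ℝ)‖ := by simp
        _ ≤ C * √n + ‖κ‖ * n := by
          refine (norm_add_le _ _).trans (add_le_add this ?_)
          rw [norm_mul]; simp
        _ ≤ _ := by nlinarith
  let U : Set ℂ := {s | 1 / 2 < s.re ∧ s.re < 1} ∪ {s | 1 / 2 < s.re ∧ 0 < s.im}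
  have hUo : IsOpen U := by
    refine IsOpen.union ?_ ?_
    · exact (isOpen_lt continuous_const continuous_re).inter (isOpen_lt continuous_re continuous_const)
    · exact (isOpen_lt continuous_const continuous_re).inter (isOpen_lt continuous_const continuous_im)
  have hUc : IsPreconnected U := by
    refine IsPreconnected.union (⟨3 / 4, 1⟩ : ℂ) ?_ ?_ ?_ ?_
    · constructor <;> norm_num
    · constructor <;> norm_num
    · exact ((convex_halfSpace_re_gt _).inter (convex_halfSpace_re_lt _)).isPreconnected
    · exact ((convex_halfSpace_re_gt _).inter (convex_halfSpace_im_gt _)).isPreconnected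
  have hU1 : ∀ s ∈ U, 1 / 2 < s.re ∧ s ≠ 1 := by
    rintro s (⟨h, h'⟩ | ⟨h, h'⟩)
    · exact ⟨h, by rintro rfl; simp at h'⟩
    · exact ⟨h, by rintro rfl; simp at h'⟩
  have hz : (⟨2, 1⟩ : ℂ) ∈ U := Or.inr ⟨by norm_num, by norm_num⟩
  have := AnalyticOnNhd.eqOn_of_preconnected_of_eventuallyEq (f := G) (g := H) (U := U)
    (DifferentiableOn.analyticOnNhd (fun s hs ↦ (hG s (hU1 s hs).2).differentiableWithinAt) hUo)
    (DifferentiableOn.analyticOnNhd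
      (fun s hs ↦ (hHd s (hU1 s hs).1 (hU1 s hs).2).differentiableWithinAt) hUo) hUc hz ?_
  · exact this (Or.inl ⟨h1, h2⟩)
  · filter_upwards [(isOpen_lt continuous_const continuous_re).mem_nhds
      (show (1 : ℝ) < (⟨2, 1⟩ : ℂ).re by norm_num)] with s hs
    exact hagree s hs

end Heil

namespace Heil

open MeasureTheory Filter Asymptotics Topology

/-- twisted coefficients on squares -/
noncomputable def sqc {q : ℕ} (χ : DirichletCharacter ℂ q) (n : ℕ) : ℂ :=
  open Classical in if IsSquare n then χ n else 0

lemma norm_sum_sqc_le {q : ℕ} (χ : DirichletCharacter ℂ q) (n : ℕ) :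
    ∑ k ∈ Finset.Icc 1 n, ‖sqc χ k‖ ≤ √(n : ℝ) := by
  classical
  have h1 : ∀ k ∈ Finset.Icc 1 n, ‖sqc χ k‖ ≤ if IsSquare k then (1 : ℝ) else 0 := by
    intro k _
    unfold sqc
    split_ifs
    · exact χ.norm_le_one _
    · simp
  refine (Finset.sum_le_sum h1).trans ?_
  rw [← Finset.sum_filter, Finset.sum_const, nsmul_eq_mul, mul_one]
  have h2 : (Finset.filter (fun k ↦ IsSquare k) (Finset.Icc 1 n)) ⊆
      (Finset.Icc 1 (Nat.sqrt n)).image (fun m ↦ m * m) := by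
    intro k hk
    simp only [Finset.mem_filter, Finset.mem_Icc] at hk
    obtain ⟨⟨hk1, hk2⟩, m, rfl⟩ := hk
    refine Finset.mem_image.mpr ⟨m, ?_, rfl⟩
    rw [Finset.mem_Icc]
    refine ⟨?_, Nat.le_sqrt.mpr hk2⟩
    rcases Nat.eq_zero_or_pos m with h | h
    · simp [h] at hk1
    · exact h
  have h3 := (Finset.card_le_card h2).trans Finset.card_image_le
  rw [Nat.card_Icc, Nat.add_sub_cancel] at h3
  calc _ ≤ ((Nat.sqrt n : ℕ) : ℝ) := by exact_mod_cast h3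
    _ ≤ _ := Real.nat_sqrt_le_real_sqrt

lemma LSeries_sqc {q : ℕ} (χ : DirichletCharacter ℂ q) (s : ℂ) :
    LSeries (sqc χ) s = LSeries (fun n ↦ (χ ^ 2) n) (2 * s) := by
  unfold LSeries
  have hinj : Function.Injective (fun n : ℕ ↦ n * n) := fun a b h ↦ by
    simpa [← sq] using h
  rw [← hinj.tsum_eq]
  · refine tsum_congr fun n ↦ ?_
    rcases eq_or_ne n 0 with rfl | hn
    · simp
    · rw [LSeries.term_of_ne_zero (by simpa using hn), LSeries.term_of_ne_zero hn]
      simp only [sqc, if_pos (IsSquare.mul_self n)]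
      congr 1
      · simp [sq]
      · rw [Nat.cast_mul, Complex.natCast_mul_natCast_cpow, ← cpow_add _ _ (by exact_mod_cast hn), two_mul]
  · intro n hn
    by_contra h
    apply hn
    have : ¬ IsSquare n := by
      rintro ⟨m, rfl⟩; exact h ⟨m, rfl⟩
    simp [LSeries.term, sqc, this]

theorem core (q : ℕ) [NeZero q] (χ : DirichletCharacter ℂ q) (ρ : ℂ)
    (hρ : DirichletCharacter.LFunction χ ρ = 0) (hρ1 : 1 / 2 < ρ.re) (hρ2 : ρ.re < 1) (C : ℝ)
    (r : ℕ → ℕ → ℂ) (N : ℕ → ℕ) (hN : ∀ j, NeZero (N j)) (ψ : ∀ j, DirichletCharacter ℂ (N j))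
    (κ : ℕ → ℂ)
    (h1 : ∀ (j n : ℕ), n ≠ 0 → χ n * r j n = χ n * ∑ m ∈ n.divisors, ψ j m)
    (h2 : ∀ j (x : ℝ), 1 ≤ x →
      ‖(∑ k ∈ Finset.Icc 1 ⌊x⌋₊, χ k * r j k) - κ j * x‖ ≤ C * √x)
    (h3 : ∀ n : ℕ, n ≠ 0 → ∀ᶠ j in atTop, χ n * r j n = sqc χ n) : False := by
  have hC : 0 ≤ C := by
    have := (norm_nonneg _).trans (h2 0 1 le_rfl)
    simpa using this
  have h3' : ∀ n : ℕ, ∀ᶠ j in atTop, ∑ k ∈ Finset.Icc 1 n, χ k * r j k =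
      ∑ k ∈ Finset.Icc 1 n, sqc χ k := by
    intro n
    have : ∀ᶠ j in atTop, ∀ k ∈ Finset.Icc 1 n, χ k * r j k = sqc χ k := by
      rw [Finset.eventually_all]
      intro k hk
      exact h3 k (by have := (Finset.mem_Icc.mp hk).1; omega)
    filter_upwards [this] with j hj
    exact Finset.sum_congr rfl hj
  -- each j
  have hj : ∀ j, (0 : ℂ) = κ j * ρ / (ρ - 1) + ρ * ∫ t in Set.Ioi (1 : ℝ),
      ((∑ k ∈ Finset.Icc 1 ⌊t⌋₊, χ k * r j k) - κ j * t) * (t : ℂ) ^ (-(ρ + 1)) := by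
    intro j
    have := hN j
    have : NeZero (q * N j) := ⟨mul_ne_zero (NeZero.ne q) (NeZero.ne _)⟩
    let χψ : DirichletCharacter ℂ (q * N j) :=
      DirichletCharacter.changeLevel (dvd_mul_right q (N j)) χ *
        DirichletCharacter.changeLevel (dvd_mul_left (N j) q) (ψ j)
    have hχψ : ∀ n : ℕ, χψ n = χ n * ψ j n := by
      intro n
      by_cases hn : IsUnit (n : ZMod (q * N j))
      · obtain ⟨u, hu⟩ := hn
        rw [← hu, MulChar.mul_apply, DirichletCharacter.changeLevel_eq_cast_of_dvd,
          DirichletCharacter.changeLevel_eq_cast_of_dvd, hu]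
        rw [ZMod.cast_natCast (dvd_mul_right q (N j)), ZMod.cast_natCast (dvd_mul_left (N j) q)]
      · rw [χψ.map_nonunit hn]
        rw [ZMod.isUnit_iff_coprime, Nat.coprime_mul_iff_right, not_and_or] at hn
        rcases hn with hn | hn
        · rw [χ.map_nonunit (by rwa [ZMod.isUnit_iff_coprime]), zero_mul]
        · rw [(ψ j).map_nonunit (by rwa [ZMod.isUnit_iff_coprime]), mul_zero]
    have hconv : ∀ n : ℕ, n ≠ 0 → χ n * r j n =
        LSeries.convolution (fun n : ℕ ↦ χψ n) (fun n : ℕ ↦ χ n) n := by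
      intro n hn
      rw [h1 j n hn, LSeries.convolution_def]
      simp only [hχψ]
      rw [Nat.sum_divisorsAntidiagonal (f := fun a b : ℕ ↦ χ a * ψ j a * χ b), Finset.mul_sum]
      refine Finset.sum_congr rfl fun m hm ↦ ?_
      have : (n : ZMod q) = (m : ZMod q) * ((n / m : ℕ) : ZMod q) := by
        rw [← Nat.cast_mul, Nat.mul_div_cancel' (Nat.dvd_of_mem_divisors hm)]
      rw [this, map_mul]; ring
    have hs1 : ∀ s : ℂ, 1 < s.re → LSeriesSummable (fun n : ℕ ↦ χψ n) s := fun s hs ↦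
      χψ.LSeriesSummable_of_one_lt_re hs
    have hs2 : ∀ s : ℂ, 1 < s.re → LSeriesSummable (fun n : ℕ ↦ χ n) s := fun s hs ↦
      χ.LSeriesSummable_of_one_lt_re hs
    have := continuation (fun n ↦ χ n * r j n) (κ j) C (h2 j)
      (fun s hs ↦ (LSeriesSummable_congr s (fun {n} hn ↦ hconv n hn)).mpr
        ((hs1 s hs).convolution (hs2 s hs)))
      (fun s ↦ DirichletCharacter.LFunction χψ s * DirichletCharacter.LFunction χ s)
      (fun s hs ↦ (DirichletCharacter.differentiableAt_LFunction _ _ (Or.inl hs)).mul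
        (DirichletCharacter.differentiableAt_LFunction _ _ (Or.inl hs)))
      (fun s hs ↦ by
        rw [LSeries_congr (fun {n} hn ↦ hconv n hn), LSeries_convolution' (hs1 s hs) (hs2 s hs),
          DirichletCharacter.LFunction_eq_LSeries _ hs, DirichletCharacter.LFunction_eq_LSeries _ hs])
      ρ hρ1 hρ2
    rw [← this, hρ, mul_zero]
  -- κ → 0
  have hκ : Tendsto κ atTop (𝓝 0) := by
    rw [NormedAddGroup.tendsto_nhds_zero]
    intro ε hε
    obtain ⟨M, hM⟩ := exists_nat_gt ((C + 1) / ε)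
    have hM0 : 0 < (M : ℝ) := lt_of_le_of_lt (by positivity) hM
    filter_upwards [h3' (M ^ 2)] with j hj
    have h4 := h2 j ((M ^ 2 : ℕ) : ℝ) (by exact_mod_cast Nat.one_le_pow _ _ (by exact_mod_cast hM0))
    rw [Nat.floor_natCast, hj] at h4
    have h5 : ‖∑ k ∈ Finset.Icc 1 (M ^ 2), sqc χ k‖ ≤ √((M ^ 2 : ℕ) : ℝ) :=
      (norm_sum_le _ _).trans (norm_sum_sqc_le χ _)
    have h6 : √((M ^ 2 : ℕ) : ℝ) = M := by
      rw [Nat.cast_pow, Real.sqrt_sq hM0.le]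
    rw [h6] at h4 h5
    have h7 : ‖κ j * ((M ^ 2 : ℕ) : ℝ)‖ = ‖κ j‖ * M ^ 2 := by
      rw [norm_mul]; simp
    have h8 : ‖κ j‖ * M ^ 2 ≤ C * M + M := by
      rw [← h7]
      calc _ = ‖(∑ k ∈ Finset.Icc 1 (M ^ 2), sqc χ k) - ((∑ k ∈ Finset.Icc 1 (M ^ 2), sqc χ k) -
            κ j * ((M ^ 2 : ℕ) : ℝ))‖ := by congr 1; ring
        _ ≤ _ := (norm_sub_le _ _).trans (by linarith)
    rw [div_lt_iff₀ hε] at hM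
    have : ‖κ j‖ * M ≤ C + 1 := by
      have : (‖κ j‖ * M) * M ≤ (C + 1) * M := by nlinarith
      exact le_of_mul_le_mul_right this hM0
    by_contra hcon
    push Not at hcon
    nlinarith
  -- limit of integrals
  have hlim := tendsto_integral_of_dominated_convergence (μ := volume.restrict (Set.Ioi (1 : ℝ)))
    (F := fun j (t : ℝ) ↦ ((∑ k ∈ Finset.Icc 1 ⌊t⌋₊, χ k * r j k) - κ j * t) *
      (t : ℂ) ^ (-(ρ + 1)))
    (f := fun t : ℝ ↦ (∑ k ∈ Finset.Icc 1 ⌊t⌋₊, sqc χ k) * (t : ℂ) ^ (-(ρ + 1)))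
    (fun t ↦ C * t ^ (-(ρ.re + 1 / 2)))
    (fun j ↦ (E_integrable _ _ C (h2 j) ρ hρ1).aestronglyMeasurable)
    ((integrableOn_Ioi_rpow_of_lt (by linarith) zero_lt_one).const_mul _)
    (fun j ↦ by
      filter_upwards [ae_restrict_mem measurableSet_Ioi] with t ht
      have ht1 : (1 : ℝ) < t := ht
      have ht0 : 0 < t := by linarith
      rw [norm_mul, Complex.norm_cpow_eq_rpow_re_of_pos ht0]
      calc _ ≤ (C * √t) * t ^ (-(ρ + 1)).re := by
            gcongr; exact h2 j t ht1.le
        _ = _ := by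
          rw [mul_assoc, Real.sqrt_eq_rpow, ← Real.rpow_add ht0]
          congr 2; simp; ring)
    (by
      filter_upwards with t
      refine Tendsto.mul_const _ ?_
      have : Tendsto (fun j ↦ (∑ k ∈ Finset.Icc 1 ⌊t⌋₊, sqc χ k) - κ j * t) atTop
          (𝓝 ((∑ k ∈ Finset.Icc 1 ⌊t⌋₊, sqc χ k) - 0 * t)) := (hκ.mul_const _).const_sub _
      rw [zero_mul, sub_zero] at this
      refine this.congr' ?_
      filter_upwards [h3' ⌊t⌋₊] with j hj
      rw [hj])
  have hlim2 := ((hκ.mul_const ρ).div_const (ρ - 1)).add (hlim.const_mul ρ)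
  have h9 := tendsto_nhds_unique (hlim2.congr (fun j ↦ (hj j).symm)) tendsto_const_nhds
  rw [zero_mul, zero_div, zero_add] at h9
  rw [← LSeries_eq_mul_integral' (sqc χ) (r := 1 / 2) (by norm_num) hρ1 ?_] at h9
  · rw [LSeries_sqc] at h9
    exact DirichletCharacter.LSeries_ne_zero_of_one_lt_re (χ ^ 2) (by simp; linarith) h9
  · refine isBigO_iff.mpr ⟨1, Eventually.of_forall fun n ↦ ?_⟩
    rw [one_mul, Real.norm_of_nonneg (by positivity), Real.norm_of_nonneg (by positivity),
      ← Real.sqrt_eq_rpow]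
    exact norm_sum_sqc_le χ n

end Heil

namespace Heil

lemma euler_factor_ne {q M : ℕ} (χ : DirichletCharacter ℂ q) (s : ℂ) (hs : 0 < s.re) :
    ∏ p ∈ M.primeFactors, (1 - χ p * (p : ℂ) ^ (-s)) ≠ 0 := by
  rw [Finset.prod_ne_zero_iff]
  intro p hp h
  have hp' := (Nat.prime_of_mem_primeFactors hp)
  have h1 : ‖χ p * (p : ℂ) ^ (-s)‖ < 1 := by
    rw [norm_mul, Complex.norm_natCast_cpow_of_pos hp'.pos]
    calc _ ≤ 1 * (p : ℝ) ^ (-s).re := by gcongr; exact χ.norm_le_one _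
      _ < 1 := by
        rw [one_mul, neg_re]
        exact Real.rpow_lt_one_of_one_lt_of_neg (by exact_mod_cast hp'.one_lt) (by linarith)
  rw [sub_eq_zero] at h
  rw [← h] at h1
  simp at h1

lemma changeLevel_zero {q M : ℕ} [NeZero q] [NeZero M] (hqM : q ∣ M) (χ : DirichletCharacter ℂ q)
    (s : ℂ) (hs1 : s ≠ 1) (h : DirichletCharacter.LFunction χ s = 0) :
    DirichletCharacter.LFunction (DirichletCharacter.changeLevel hqM χ) s = 0 := by
  rw [DirichletCharacter.LFunction_changeLevel hqM χ (Or.inr hs1), h, zero_mul]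

lemma reflect (q : ℕ) [NeZero q] (χ : DirichletCharacter ℂ q) (hχ : χ ^ 2 = 1) (s : ℂ)
    (h : DirichletCharacter.LFunction χ s = 0) (h0 : 0 < s.re) (h1 : s.re < 1)
    (h2 : s.re ≠ 1 / 2) : ∃ (q' : ℕ) (_ : NeZero q') (χ' : DirichletCharacter ℂ q') (ρ : ℂ),
      DirichletCharacter.LFunction χ' ρ = 0 ∧ 1 / 2 < ρ.re ∧ ρ.re < 1 := by
  rcases lt_or_gt_of_ne h2 with h2 | h2
  · have hs1 : s ≠ 1 := by rintro rfl; simp at h1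
    have hs0 : s ≠ 0 := by rintro rfl; simp at h0
    set c := χ.conductor
    have : NeZero c := ⟨χ.conductor_ne_zero⟩
    set χ' := χ.primitiveCharacter with hχ'
    have hp : χ'.IsPrimitive := χ.primitiveCharacter_isPrimitive
    have hcl : χ = DirichletCharacter.changeLevel χ.conductor_dvd_level χ' :=
      χ.changeLevel_primitiveCharacter.symm
    have hsq : χ' ^ 2 = 1 := by
      apply DirichletCharacter.changeLevel_injective χ.conductor_dvd_level
      rw [map_pow, ← hcl, hχ, map_one]
    have hinv : χ'⁻¹ = χ' := by
      rw [inv_eq_iff_mul_eq_one, ← sq, hsq]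
    have hL : DirichletCharacter.LFunction χ' s = 0 := by
      rw [hcl, DirichletCharacter.LFunction_changeLevel _ _ (Or.inr hs1)] at h
      exact (mul_eq_zero.mp h).resolve_right (euler_factor_ne χ' s h0)
    have hg : ∀ z : ℂ, 0 < z.re → DirichletCharacter.gammaFactor χ' z ≠ 0 := by
      intro z hz
      rcases χ'.even_or_odd with he | ho
      · rw [he.gammaFactor_def]
        exact Complex.Gammaℝ_ne_zero_of_re_pos hz
      · rw [ho.gammaFactor_def]
        exact Complex.Gammaℝ_ne_zero_of_re_pos (by simp; linarith)
    rw [DirichletCharacter.LFunction_eq_completed_div_gammaFactor _ _ (Or.inl hs0),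
      div_eq_zero_iff] at hL
    have hL' := hL.resolve_right (hg s h0)
    refine ⟨c, inferInstance, χ', 1 - s, ?_, by simp; linarith, by simp; linarith⟩
    rw [DirichletCharacter.LFunction_eq_completed_div_gammaFactor _ _
      (Or.inl (sub_ne_zero.mpr hs1.symm)), hp.completedLFunction_one_sub, hinv, hL']
    simp
  · exact ⟨q, inferInstance, χ, s, h, h2, h1⟩

end Heil

namespace Heil

lemma card_Icc_approx (a b : ℝ) (h : a ≤ b) :
    |((Finset.Icc ⌈a⌉ ⌊b⌋).card : ℝ) - (b - a)| ≤ 1 := by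
  have h1 := Int.floor_le b
  have h2 := Int.lt_floor_add_one b
  have h3 := Int.le_ceil a
  have h4 := Int.ceil_lt_add_one a
  have h5 : (0 : ℤ) ≤ ⌊b⌋ + 1 - ⌈a⌉ := by
    have : (-1 : ℝ) < ((⌊b⌋ + 1 - ⌈a⌉ : ℤ) : ℝ) := by push_cast; linarith
    have : (-1 : ℤ) < (⌊b⌋ + 1 - ⌈a⌉ : ℤ) := by exact_mod_cast this
    omega
  rw [Int.card_Icc]
  have h6 : (((⌊b⌋ + 1 - ⌈a⌉).toNat : ℕ) : ℝ) = ((⌊b⌋ + 1 - ⌈a⌉ : ℤ) : ℝ) := by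
    exact_mod_cast Int.toNat_of_nonneg h5
  rw [h6, abs_le]
  push_cast
  constructor <;> linarith

lemma row_set (q : ℕ) (hq : 0 < q) (c w : ℝ) :
    {j : ℤ | |(q : ℝ) * j + c| ≤ w} =
      ↑(Finset.Icc ⌈(-c - w) / q⌉ ⌊(-c + w) / q⌋) := by
  have hq' : (0 : ℝ) < q := by exact_mod_cast hq
  ext j
  simp only [Set.mem_setOf_eq, Finset.coe_Icc, Set.mem_Icc, Int.ceil_le, Int.le_floor]
  rw [div_le_iff₀ hq', le_div_iff₀ hq', abs_le]
  constructor <;> rintro ⟨h1, h2⟩ <;> constructor <;> linarith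

lemma row_count (q : ℕ) (hq : 0 < q) (c w : ℝ) (hw : 0 ≤ w) :
    |({j : ℤ | |(q : ℝ) * j + c| ≤ w}.ncard : ℝ) - 2 * w / q| ≤ 1 := by
  have hq' : (0 : ℝ) < q := by exact_mod_cast hq
  rw [row_set q hq, Set.ncard_coe_finset]
  have := card_Icc_approx ((-c - w) / q) ((-c + w) / q) (by gcongr; linarith)
  convert this using 3
  field_simp; ring

lemma half_sum (g : ℝ → ℝ) (hg : AntitoneOn g (Set.Ici 0)) (hg0 : ∀ t, 0 ≤ g t) (V : ℝ)
    (hV : 0 ≤ V) (hgV : ∀ t, V ≤ t → g t = 0) (n : ℕ) (hn : V ≤ n) (t : ℝ) (ht0 : 0 ≤ t)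
    (ht1 : t ≤ 1) : |(∑ i ∈ Finset.range n, g (t + i)) - ∫ s in (0 : ℝ)..V, g s| ≤ g 0 := by
  have hgInt : ∀ a b : ℝ, 0 ≤ a → 0 ≤ b → IntervalIntegrable g MeasureTheory.volume a b := by
    intro a b ha hb
    refine (hg.mono ?_).intervalIntegrable
    intro x hx
    exact (le_min ha hb).trans hx.1
  have hn0 : (0 : ℝ) ≤ n := n.cast_nonneg
  have hant : AntitoneOn g (Set.Icc t (t + n)) := hg.mono fun x hx ↦ ht0.trans hx.1
  have e1 := hant.integral_le_sum
  have e2 := hant.sum_le_integral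
  have hIV : ∀ b, V ≤ b → ∫ s in (0 : ℝ)..b, g s = ∫ s in (0 : ℝ)..V, g s := by
    intro b hb
    rw [← intervalIntegral.integral_add_adjacent_intervals (hgInt 0 V le_rfl hV)
      (hgInt V b hV (hV.trans hb))]
    have : ∫ s in V..b, g s = ∫ s in V..b, (0 : ℝ) := by
      apply intervalIntegral.integral_congr
      intro s hs
      rw [Set.uIcc_of_le hb] at hs
      exact hgV s hs.1
    rw [this]; simp
  have e3 : ∫ s in t..(t + n), g s = (∫ s in (0 : ℝ)..V, g s) - ∫ s in (0 : ℝ)..t, g s := by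
    rw [← hIV (t + n) (by linarith), ← intervalIntegral.integral_add_adjacent_intervals
      (hgInt 0 t le_rfl ht0) (hgInt t (t + n) ht0 (by linarith))]
    ring
  have e4 : 0 ≤ ∫ s in (0 : ℝ)..t, g s :=
    intervalIntegral.integral_nonneg ht0 fun s _ ↦ hg0 s
  have e5 : ∫ s in (0 : ℝ)..t, g s ≤ g 0 := by
    have : ∫ s in (0 : ℝ)..t, g s ≤ ∫ s in (0 : ℝ)..t, g 0 :=
      intervalIntegral.integral_mono_on ht0 (hgInt 0 t le_rfl ht0) (by simp)
        fun s hs ↦ hg (Set.mem_Ici.mpr le_rfl) hs.1 hs.1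
    refine this.trans ?_
    rw [intervalIntegral.integral_const, smul_eq_mul, sub_zero]
    exact mul_le_of_le_one_left (hg0 0) ht1
  have e6 : ∑ i ∈ Finset.range n, g (t + i) =
      (∑ i ∈ Finset.range n, g (t + ((i + 1 : ℕ) : ℝ))) + g t - g (t + n) := by
    have h1 := Finset.sum_range_succ (fun i : ℕ ↦ g (t + i)) n
    have h2 := Finset.sum_range_succ' (fun i : ℕ ↦ g (t + i)) n
    simp only [Nat.cast_zero, add_zero] at h2
    linarith
  have e7 : g t ≤ g 0 := hg (Set.mem_Ici.mpr le_rfl) ht0 ht0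
  have e8 := hg0 (t + n)
  rw [abs_le]
  constructor
  · linarith
  · rw [e6]; linarith

lemma full_sum (g : ℝ → ℝ) (hg : AntitoneOn g (Set.Ici 0)) (hg0 : ∀ t, 0 ≤ g t)
    (heven : ∀ t, g (-t) = g t) (V : ℝ)
    (hV : 0 ≤ V) (hgV : ∀ t, V ≤ t → g t = 0) (n : ℕ) (hn : V ≤ n) (t : ℝ) (ht0 : 0 ≤ t)
    (ht1 : t ≤ 1) :
    |(∑ k ∈ Finset.Ico (-(n : ℤ)) n, g (k + t)) - 2 * ∫ s in (0 : ℝ)..V, g s| ≤ 2 * g 0 := by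
  have h1 := half_sum g hg hg0 V hV hgV n hn t ht0 ht1
  have h2 := half_sum g hg hg0 V hV hgV n hn (1 - t) (by linarith) (by linarith)
  have h3 : ∑ k ∈ Finset.Ico (-(n : ℤ)) n, g (k + t) =
      (∑ i ∈ Finset.range n, g (t + i)) + ∑ i ∈ Finset.range n, g (1 - t + i) := by
    have hdis : Finset.Ico (-(n : ℤ)) n = Finset.Ico (-(n : ℤ)) 0 ∪ Finset.Ico (0 : ℤ) n := by
      rw [Finset.Ico_union_Ico_eq_Ico] <;> omega
    rw [hdis, Finset.sum_union (Finset.Ico_disjoint_Ico_consecutive _ _ _), add_comm]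
    congr 1
    · symm
      refine Finset.sum_bij (fun (i : ℕ) _ ↦ (i : ℤ)) ?_ ?_ ?_ ?_
      · intro i hi; simp at hi ⊢; omega
      · intro i _ j _ h; simpa using h
      · intro k hk
        simp at hk
        exact ⟨k.toNat, by simp; omega, by simp; omega⟩
      · intro i _; simp [add_comm]
    · symm
      refine Finset.sum_bij (fun (i : ℕ) _ ↦ (-1 - i : ℤ)) ?_ ?_ ?_ ?_
      · intro i hi; simp at hi ⊢; omega
      · intro i _ j _ h; simpa using h
      · intro k hk
        simp at hk
        exact ⟨(-1 - k).toNat, by simp; omega, by simp; omega⟩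
      · intro i _
        rw [← heven]; congr 1; push_cast; ring
  rw [h3]
  rw [abs_le] at h1 h2 ⊢
  constructor <;> linarith [h1.1, h1.2, h2.1, h2.2]

end Heil

namespace Heil

/-- lattice points congruent to `(r1, r2)` in the ellipse `Q ≤ x` -/
def ellS (A B C : ℤ) (q r1 r2 : ℕ) (x : ℝ) : Set (ℤ × ℤ) :=
  {p | ((A * (q * p.1 + r1) ^ 2 + B * (q * p.1 + r1) * (q * p.2 + r2) +
    C * (q * p.2 + r2) ^ 2 : ℤ) : ℝ) ≤ x}

lemma ell_count (A B C : ℤ) (hA : 1 ≤ A) (hB : |B| ≤ A) (hC : A ≤ C) (q : ℕ) (hq : 0 < q) :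
    ∃ κ : ℝ, ∀ (r1 r2 : ℕ), r2 < q → ∀ x : ℝ, 1 ≤ x →
      (ellS A B C q r1 r2 x).Finite ∧
      |((ellS A B C q r1 r2 x).ncard : ℝ) - κ * x| ≤ 8 * √x := by
  have hq' : (0 : ℝ) < q := by exact_mod_cast hq
  have hq1 : (1 : ℝ) ≤ q := by exact_mod_cast hq
  obtain ⟨a, ha⟩ : ∃ a : ℝ, a = A := ⟨_, rfl⟩
  obtain ⟨b, hb⟩ : ∃ a : ℝ, a = B := ⟨_, rfl⟩
  obtain ⟨c, hc⟩ : ∃ a : ℝ, a = C := ⟨_, rfl⟩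
  have ha1 : 1 ≤ a := by rw [ha]; exact_mod_cast hA
  have hba : |b| ≤ a := by rw [ha, hb]; exact_mod_cast hB
  have hac : a ≤ c := by rw [ha, hc]; exact_mod_cast hC
  have ha0 : 0 < a := by linarith
  set δ : ℝ := c - b ^ 2 / (4 * a) with hδdef
  have hb2 : b ^ 2 ≤ a ^ 2 := by rw [← sq_abs b]; gcongr
  have hδ : 3 / 4 ≤ δ := by
    have : b ^ 2 / (4 * a) ≤ a / 4 := by
      rw [div_le_div_iff₀ (by positivity) (by norm_num)]; nlinarith
    rw [hδdef]; linarith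
  have hδ0 : 0 < δ := by linarith
  have hQ : ∀ u v : ℝ, a * u ^ 2 + b * u * v + c * v ^ 2 =
      a * (u + b * v / (2 * a)) ^ 2 + δ * v ^ 2 := by
    intro u v; rw [hδdef]; field_simp; ring
  refine ⟨4 / q * ∫ s in (0 : ℝ)..(√(1 / δ) / q), √((1 - δ * (q * s) ^ 2) / a), ?_⟩
  intro r1 r2 hr x hx
  have hx0 : 0 < x := by linarith
  have hsx : 1 ≤ √x := by rw [Real.one_le_sqrt]; exact hx
  set w : ℝ → ℝ := fun v ↦ √((x - δ * v ^ 2) / a) with hw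
  set W : ℝ := √(x / δ) with hWdef
  have hW0 : 0 ≤ W := Real.sqrt_nonneg _
  have hW2 : W ^ 2 = x / δ := Real.sq_sqrt (by positivity)
  have hvW : ∀ v : ℝ, |v| ≤ W ↔ δ * v ^ 2 ≤ x := by
    intro v
    rw [← abs_of_nonneg hW0, ← sq_le_sq, hW2, le_div_iff₀ hδ0, mul_comm]
  set K0 : Finset ℤ := Finset.Icc ⌈(-(r2 : ℝ) - W) / q⌉ ⌊(-(r2 : ℝ) + W) / q⌋ with hK0
  have hK0mem : ∀ k : ℤ, k ∈ K0 ↔ δ * ((q : ℝ) * k + r2) ^ 2 ≤ x := by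
    intro k
    rw [← hvW]
    have := row_set q hq r2 W
    have h2 : k ∈ (↑K0 : Set ℤ) ↔ k ∈ {j : ℤ | |(q : ℝ) * j + r2| ≤ W} := by rw [this]
    simpa using h2
  have hWx : W ≤ 1.2 * √x := by
    rw [hWdef]
    apply Real.sqrt_le_iff.mpr
    refine ⟨by positivity, ?_⟩
    rw [mul_pow, Real.sq_sqrt hx0.le, div_le_iff₀ hδ0]
    nlinarith
  have hK0card : (K0.card : ℝ) ≤ 4 * √x := by
    have := row_count q hq r2 W hW0
    rw [row_set q hq, Set.ncard_coe_finset, abs_le] at this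
    have h2 : 2 * W / q ≤ 2 * W := div_le_self (by linarith) hq1
    change (K0.card : ℝ) ≤ _
    linarith [this.2]
  set cc : ℤ → ℝ := fun k ↦ r1 + b * ((q : ℝ) * k + r2) / (2 * a) with hcc
  set Row : ℤ → Finset ℤ := fun k ↦ Finset.Icc ⌈(-cc k - w (q * k + r2)) / q⌉
    ⌊(-cc k + w (q * k + r2)) / q⌋ with hRow
  have hRowmem : ∀ k j : ℤ, j ∈ Row k ↔ |(q : ℝ) * j + cc k| ≤ w (q * k + r2) := by
    intro k j
    have := row_set q hq (cc k) (w (q * k + r2))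
    have h2 : j ∈ (↑(Row k) : Set ℤ) ↔ j ∈ {j : ℤ | |(q : ℝ) * j + cc k| ≤ w (q * k + r2)} := by
      rw [this]
    simpa using h2
  have hRowcard : ∀ k, |((Row k).card : ℝ) - 2 * w (q * k + r2) / q| ≤ 1 := by
    intro k
    have := row_count q hq (cc k) (w (q * k + r2)) (Real.sqrt_nonneg _)
    rwa [row_set q hq, Set.ncard_coe_finset] at this
  set F : Finset (Σ _ : ℤ, ℤ) := K0.sigma Row with hF
  have hSF : ellS A B C q r1 r2 x = (fun p : (Σ _ : ℤ, ℤ) ↦ (p.2, p.1)) '' (F : Set _) := by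
    ext ⟨j, k⟩
    have key : ((j, k) ∈ ellS A B C q r1 r2 x) ↔ (k ∈ K0 ∧ j ∈ Row k) := by
      simp only [ellS, Set.mem_ofPred_eq]
      push_cast
      rw [← ha, ← hb, ← hc, hQ, hK0mem, hRowmem]
      have e : (q : ℝ) * j + r1 + b * (q * k + r2) / (2 * a) = q * j + cc k := by
        simp only [hcc]; ring
      rw [e]
      set y := (q : ℝ) * j + cc k
      set v := (q : ℝ) * k + r2
      have : |y| ≤ w v ↔ |y| ≤ √((x - δ * v ^ 2) / a) := Iff.rfl
      rw [this]
      constructor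
      · intro h
        have h1 : 0 ≤ a * y ^ 2 := by positivity
        refine ⟨by linarith, ?_⟩
        apply Real.abs_le_sqrt
        rw [le_div_iff₀ ha0]; linarith
      · rintro ⟨h1, h2⟩
        have h3 : y ^ 2 ≤ (x - δ * v ^ 2) / a := by
          have h4 : (0:ℝ) ≤ (x - δ * v ^ 2) / a := div_nonneg (by linarith) ha0.le
          rw [← Real.sq_sqrt h4, ← sq_abs y]
          gcongr
        rw [le_div_iff₀ ha0] at h3
        linarith
    rw [key]
    constructor
    · rintro ⟨h1, h2⟩
      exact ⟨⟨k, j⟩, by simp [hF, h1, h2], rfl⟩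
    · rintro ⟨⟨k', j'⟩, h1, h2⟩
      simp only [Prod.mk.injEq] at h2
      obtain ⟨rfl, rfl⟩ := h2
      simpa [hF] using h1
  refine ⟨by rw [hSF]; exact F.finite_toSet.image _, ?_⟩
  have hncard : ((ellS A B C q r1 r2 x).ncard : ℝ) = ∑ k ∈ K0, ((Row k).card : ℝ) := by
    rw [hSF, Set.ncard_image_of_injective, Set.ncard_coe_finset, hF, Finset.card_sigma]
    · push_cast; rfl
    · rintro ⟨k, j⟩ ⟨k', j'⟩ h
      simp only [Prod.mk.injEq] at h
      obtain ⟨rfl, rfl⟩ := h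
      rfl
  have e1 : |(∑ k ∈ K0, ((Row k).card : ℝ)) - ∑ k ∈ K0, 2 * w (q * k + r2) / q| ≤ 4 * √x := by
    rw [← Finset.sum_sub_distrib]
    refine (Finset.abs_sum_le_sum_abs _ _).trans ?_
    refine (Finset.sum_le_sum fun k _ ↦ hRowcard k).trans ?_
    simpa using hK0card
  set g : ℝ → ℝ := fun s ↦ w (q * s) with hg
  have hganti : AntitoneOn g (Set.Ici 0) := by
    intro s hs t ht hst
    simp only [Set.mem_Ici] at hs ht
    simp only [hg, hw]
    gcongr
  have hg0 : ∀ t, 0 ≤ g t := fun t ↦ Real.sqrt_nonneg _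
  have hgeven : ∀ t, g (-t) = g t := by intro t; simp [hg, hw]
  have hgV' : ∀ t, W / q ≤ |t| → g t = 0 := by
    intro t ht
    rw [div_le_iff₀ hq'] at ht
    simp only [hg, hw]
    apply Real.sqrt_eq_zero_of_nonpos
    apply div_nonpos_of_nonpos_of_nonneg _ ha0.le
    have : W ^ 2 ≤ (q * t) ^ 2 := by
      rw [← sq_abs (q * t), abs_mul, abs_of_pos hq']
      gcongr
      linarith
    rw [hW2, div_le_iff₀ hδ0] at this
    linarith
  have hgV : ∀ t, W / q ≤ t → g t = 0 := fun t ht ↦ hgV' t (ht.trans (le_abs_self t))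
  set n : ℕ := ⌈W / q⌉₊ + 1 with hn
  have hnV : W / q ≤ n := by
    rw [hn]; push_cast; linarith [Nat.le_ceil (W / q)]
  have hr2 : (r2 : ℝ) / q ≤ 1 := by
    rw [div_le_one hq']; exact_mod_cast hr.le
  have hr20 : 0 ≤ (r2 : ℝ) / q := by positivity
  have e2 := full_sum g hganti hg0 hgeven (W / q) (by positivity) hgV n hnV (r2 / q) hr20 hr2
  have e3 : ∑ k ∈ K0, w (q * k + r2) = ∑ k ∈ Finset.Ico (-(n : ℤ)) n, g (k + r2 / q) := by
    have hgk : ∀ k : ℤ, w (q * k + r2) = g (k + r2 / q) := by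
      intro k; simp only [hg]; congr 1; field_simp
    simp_rw [hgk]
    apply Finset.sum_subset
    · intro k hk
      rw [hK0mem, ← hvW, abs_le] at hk
      have hk1 : -n < (k : ℝ) + 1 := by
        have h1 : -(W / q) ≤ k + r2 / q := by
          rw [← neg_div, div_le_iff₀ hq', add_mul, div_mul_cancel₀ _ hq'.ne']; linarith [hk.1]
        have h2 : W / q < n := by rw [hn]; push_cast; linarith [Nat.le_ceil (W / q)]
        linarith
      have hk2 : (k : ℝ) < n := by
        have h1 : k + r2 / q ≤ (W / q) := by
          rw [le_div_iff₀ hq', add_mul, div_mul_cancel₀ _ hq'.ne']; linarith [hk.2]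
        have h2 : W / q < n := by rw [hn]; push_cast; linarith [Nat.le_ceil (W / q)]
        linarith
      have hk1' : -(n : ℤ) < k + 1 := by exact_mod_cast hk1
      have hk2' : k < (n : ℤ) := by exact_mod_cast hk2
      simp only [Finset.mem_Ico]; omega
    · intro k _ hk
      rw [hK0mem, ← hvW, not_le] at hk
      apply hgV'
      rw [div_le_iff₀ hq']
      have : |(k : ℝ) + r2 / q| * q = |(q : ℝ) * k + r2| := by
        nth_rewrite 2 [← abs_of_pos hq']
        rw [← abs_mul]; congr 1; field_simp
      rw [this]; exact hk.le
  have e4 : g 0 ≤ √x := by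
    simp only [hg, hw]
    apply Real.sqrt_le_sqrt
    simp
    exact div_le_self hx0.le ha1
  have e5 : ∫ s in (0 : ℝ)..(W / q), g s =
      x * ∫ s in (0 : ℝ)..(√(1 / δ) / q), √((1 - δ * (q * s) ^ 2) / a) := by
    have h1 : ∀ s, g s = √x * (fun s ↦ √((1 - δ * (q * s) ^ 2) / a)) (s / √x) := by
      intro s
      simp only [hg, hw]
      rw [← Real.sqrt_mul hx0.le]
      congr 1
      have : (√x) ^ 2 = x := Real.sq_sqrt hx0.le
      have h0 : √x ≠ 0 := by positivity
      rw [mul_pow, mul_pow, div_pow, this]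
      field_simp
    rw [intervalIntegral.integral_congr (fun s _ ↦ h1 s)]
    rw [intervalIntegral.integral_const_mul, intervalIntegral.integral_comp_div
      (fun s ↦ √((1 - δ * (q * s) ^ 2) / a)) (by positivity : √x ≠ 0),
      smul_eq_mul, ← mul_assoc, Real.mul_self_sqrt hx0.le, zero_div]
    congr 2
    rw [hWdef, div_right_comm, Real.sqrt_div hx0.le, Real.sqrt_div zero_le_one, Real.sqrt_one]
    field_simp
  have e6 : ∑ k ∈ K0, 2 * w (q * k + r2) / q = 2 / q * ∑ k ∈ K0, w (q * k + r2) := by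
    rw [Finset.mul_sum]; refine Finset.sum_congr rfl fun k _ ↦ by ring
  rw [hncard]
  rw [e6, e3] at e1
  rw [e5] at e2
  set I := ∫ s in (0 : ℝ)..(√(1 / δ) / q), √((1 - δ * (q * s) ^ 2) / a)
  set S1 := ∑ k ∈ K0, ((Row k).card : ℝ)
  set S2 := ∑ k ∈ Finset.Ico (-(n : ℤ)) n, g (k + r2 / q)
  have e7 : S1 - 4 / q * I * x = (S1 - 2 / q * S2) + 2 / q * (S2 - 2 * (x * I)) := by ring
  rw [e7]
  refine (abs_add_le _ _).trans ?_
  have e8 : |2 / q * (S2 - 2 * (x * I))| ≤ 4 * √x := by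
    rw [abs_mul, abs_of_pos (by positivity : (0:ℝ) < 2 / q)]
    have : (2 : ℝ) / q ≤ 2 := div_le_self (by norm_num) hq1
    calc (2 : ℝ) / q * |S2 - 2 * (x * I)| ≤ 2 * (2 * g 0) := by gcongr
      _ ≤ 4 * √x := by linarith
  linarith

end Heil

namespace Heil

/-- binary quadratic form -/
def QF (A B C : ℤ) (p : ℤ × ℤ) : ℤ := A * p.1 ^ 2 + B * p.1 * p.2 + C * p.2 ^ 2

/-- representation number -/
noncomputable def RQ (A B C : ℤ) (n : ℕ) : ℕ := Nat.card {p : ℤ × ℤ // QF A B C p = n}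

lemma form_sum_reduced (A B C : ℤ) (hA : 1 ≤ A) (hB : |B| ≤ A) (hC : A ≤ C) (q : ℕ) [NeZero q]
    (χ : DirichletCharacter ℂ q) :
    ∃ κ : ℂ, ∀ x : ℝ, 1 ≤ x →
      ‖(∑ k ∈ Finset.Icc 1 ⌊x⌋₊, χ k * RQ A B C k) - κ * x‖ ≤ (8 * q ^ 2 + 1) * √x := by
  have hq : 0 < q := Nat.pos_of_neZero q
  obtain ⟨κ, hκ⟩ := ell_count A B C hA hB hC q hq
  obtain ⟨κ1, hκ1⟩ := ell_count A B C hA hB hC 1 one_pos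
  have hpos : ∀ p, 0 ≤ QF A B C p ∧ (QF A B C p = 0 → p = 0) := by
    rintro ⟨u, v⟩
    have hB1 := abs_le.mp hB
    have h1 : 4 * A * QF A B C (u, v) = (2 * A * u + B * v) ^ 2 + (4 * A * C - B ^ 2) * v ^ 2 := by
      simp only [QF]; ring
    have h2 : 0 < 4 * A * C - B ^ 2 := by
      have : B ^ 2 ≤ A ^ 2 := by rw [← sq_abs B]; gcongr
      nlinarith
    have h3 : 0 ≤ 4 * A * QF A B C (u, v) := by rw [h1]; positivity
    refine ⟨by nlinarith, ?_⟩
    intro h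
    rw [h, mul_zero] at h1
    have h4 : (4 * A * C - B ^ 2) * v ^ 2 = 0 := by
      nlinarith [sq_nonneg (2 * A * u + B * v), sq_nonneg v]
    have h5 : v = 0 := by
      rcases mul_eq_zero.mp h4 with h | h
      · omega
      · exact pow_eq_zero_iff (two_ne_zero) |>.mp h
    subst h5
    have h6 : u = 0 := by
      simp only [QF] at h
      have : A * u ^ 2 = 0 := by linarith
      rcases mul_eq_zero.mp this with h | h
      · omega
      · exact pow_eq_zero_iff (two_ne_zero) |>.mp h
    subst h6; rfl
  refine ⟨(∑ r ∈ Finset.range q ×ˢ Finset.range q,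
    χ ((QF A B C ((r.1 : ℤ), (r.2 : ℤ)) : ℤ) : ZMod q)) * κ, ?_⟩
  intro x hx
  have hx0 : 0 ≤ x := by linarith
  have hsx : 1 ≤ √x := by rw [Real.one_le_sqrt]; exact hx
  have hfin : {p : ℤ × ℤ | (QF A B C p : ℝ) ≤ x}.Finite := by
    have := (hκ1 0 0 one_pos x hx).1
    convert this using 1
    ext p
    simp [ellS, QF]
  set E := hfin.toFinset with hE
  have hEmem : ∀ p, p ∈ E ↔ (QF A B C p : ℝ) ≤ x := by intro p; simp [hE]
  have hEN : ∀ p, p ∈ E ↔ (QF A B C p).toNat ∈ Finset.range (⌊x⌋₊ + 1) := by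
    intro p
    rw [hEmem, Finset.mem_range, Nat.lt_succ_iff, Nat.le_floor_iff hx0]
    have : (((QF A B C p).toNat : ℤ) : ℝ) = (QF A B C p : ℝ) := by
      rw [Int.toNat_of_nonneg (hpos p).1]
    rw [← this]; norm_cast
  have hR : ∀ k ∈ Finset.range (⌊x⌋₊ + 1), RQ A B C k =
      (E.filter (fun p ↦ (QF A B C p).toNat = k)).card := by
    intro k hk
    have h1 : RQ A B C k = {p : ℤ × ℤ | QF A B C p = k}.ncard := rfl
    rw [h1, ← Set.ncard_coe_finset]
    congr 1
    ext p
    simp only [Set.mem_ofPred_eq, Finset.coe_filter]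
    rw [hEN]
    have := (hpos p).1
    constructor
    · intro h; rw [h]; simpa using hk
    · rintro ⟨_, h⟩; omega
  have hs1 : ∑ k ∈ Finset.range (⌊x⌋₊ + 1), χ k * RQ A B C k =
      ∑ p ∈ E, χ ((QF A B C p : ℤ) : ZMod q) := by
    rw [← Finset.sum_fiberwise_of_maps_to (s := E) (t := Finset.range (⌊x⌋₊ + 1))
      (g := fun p ↦ (QF A B C p).toNat) (fun p hp ↦ (hEN p).mp hp)]
    refine Finset.sum_congr rfl fun k hk ↦ ?_
    rw [hR k hk, Finset.sum_congr rfl (g := fun _ ↦ χ (k : ℕ)), Finset.sum_const, nsmul_eq_mul,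
      mul_comm]
    intro p hp
    rw [Finset.mem_filter] at hp
    have : QF A B C p = k := by
      rw [← hp.2, Int.toNat_of_nonneg (hpos p).1]
    rw [this]; simp
  have hs2 : ∑ k ∈ Finset.range (⌊x⌋₊ + 1), χ k * RQ A B C k =
      χ (0 : ℕ) + ∑ k ∈ Finset.Icc 1 ⌊x⌋₊, χ k * RQ A B C k := by
    have : Finset.range (⌊x⌋₊ + 1) = insert 0 (Finset.Icc 1 ⌊x⌋₊) := by
      ext k; simp; omega
    rw [this, Finset.sum_insert (by simp)]
    congr 1
    have h1 : RQ A B C 0 = 1 := by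
      rw [RQ, Nat.card_eq_one_iff_unique]
      refine ⟨⟨?_⟩, ⟨⟨0, by simp [QF]⟩⟩⟩
      rintro ⟨a, ha⟩ ⟨b, hb⟩
      simp at ha hb
      rw [Subtype.mk.injEq, (hpos a).2 ha, (hpos b).2 hb]
    rw [h1]; simp
  have hs3 : ∑ p ∈ E, χ ((QF A B C p : ℤ) : ZMod q) =
      ∑ r ∈ Finset.range q ×ˢ Finset.range q,
        χ ((QF A B C ((r.1 : ℤ), (r.2 : ℤ)) : ℤ) : ZMod q) * (ellS A B C q r.1 r.2 x).ncard := by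
    rw [← Finset.sum_fiberwise_of_maps_to (s := E) (t := Finset.range q ×ˢ Finset.range q)
      (g := fun p ↦ ((p.1 % q).toNat, (p.2 % q).toNat))]
    · refine Finset.sum_congr rfl fun r hr ↦ ?_
      rw [Finset.sum_congr rfl (g := fun _ ↦ χ ((QF A B C ((r.1 : ℤ), (r.2 : ℤ)) : ℤ) : ZMod q)),
        Finset.sum_const, nsmul_eq_mul, mul_comm]
      · congr 2
        rw [← Set.ncard_coe_finset]
        symm
        refine Set.ncard_congr (fun p _ ↦ (q * p.1 + r.1, q * p.2 + r.2)) ?_ ?_ ?_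
        · intro p hp
          simp only [Finset.coe_filter, Set.mem_ofPred_eq, hEmem]
          refine ⟨?_, ?_⟩
          · simpa [ellS, QF] using hp
          · simp only [Finset.mem_product, Finset.mem_range] at hr
            rw [Prod.ext_iff]
            simp only [Int.mul_add_emod_self_left]
            rw [Int.emod_eq_of_lt (by omega) (by omega), Int.emod_eq_of_lt (by omega) (by omega)]
            simp
        · rintro ⟨a, b⟩ ⟨c, d⟩ _ _ h
          have hq0 : q ≠ 0 := hq.ne'
          simpa [hq0] using h
        · intro p hp
          simp only [Finset.coe_filter, Set.mem_ofPred_eq, hEmem, Prod.ext_iff] at hp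
          have hq0 : (0 : ℤ) < q := by exact_mod_cast hq
          have h1 := Int.emod_nonneg p.1 hq0.ne'
          have h2 := Int.emod_nonneg p.2 hq0.ne'
          have h3 := Int.mul_ediv_add_emod p.1 q
          have h4 := Int.mul_ediv_add_emod p.2 q
          have h5 : (q : ℤ) * (p.1 / q) + r.1 = p.1 := by rw [← hp.2.1]; omega
          have h6 : (q : ℤ) * (p.2 / q) + r.2 = p.2 := by rw [← hp.2.2]; omega
          refine ⟨(p.1 / q, p.2 / q), ?_, ?_⟩
          · simp only [ellS, Set.mem_ofPred_eq]
            rw [h5, h6]; exact hp.1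
          · simp only [h5, h6]
      · intro p hp
        simp only [Finset.mem_filter, Prod.ext_iff] at hp
        have hq0 : (0 : ℤ) < q := by exact_mod_cast hq
        have h1 := Int.emod_nonneg p.1 hq0.ne'
        have h2 := Int.emod_nonneg p.2 hq0.ne'
        have h5 : ((r.1 : ℤ) : ZMod q) = (p.1 : ZMod q) := by
          rw [← hp.2.1, Int.toNat_of_nonneg h1]; simp
        have h6 : ((r.2 : ℤ) : ZMod q) = (p.2 : ZMod q) := by
          rw [← hp.2.2, Int.toNat_of_nonneg h2]; simp
        simp only [QF, Int.cast_add, Int.cast_mul, Int.cast_pow, h5, h6]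
    · intro p hp
      have hq0 : (0 : ℤ) < q := by exact_mod_cast hq
      have h1 := Int.emod_nonneg p.1 hq0.ne'
      have h2 := Int.emod_nonneg p.2 hq0.ne'
      have h3 := Int.emod_lt_of_pos p.1 hq0
      have h4 := Int.emod_lt_of_pos p.2 hq0
      simp only [Finset.mem_product, Finset.mem_range]
      omega
  rw [show ∑ k ∈ Finset.Icc 1 ⌊x⌋₊, χ k * RQ A B C k = (∑ r ∈ Finset.range q ×ˢ Finset.range q,
        χ ((QF A B C ((r.1 : ℤ), (r.2 : ℤ)) : ℤ) : ZMod q) * (ellS A B C q r.1 r.2 x).ncard)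
        - χ (0 : ℕ) by rw [← hs3, ← hs1, hs2]; ring]
  rw [Finset.sum_mul, Finset.sum_mul, sub_right_comm, ← Finset.sum_sub_distrib]
  refine (norm_sub_le _ _).trans ?_
  rw [add_mul, one_mul]
  refine add_le_add ?_ ((χ.norm_le_one _).trans hsx)
  refine (norm_sum_le _ _).trans ?_
  have : ∀ r ∈ Finset.range q ×ˢ Finset.range q,
      ‖χ ((QF A B C ((r.1 : ℤ), (r.2 : ℤ)) : ℤ) : ZMod q) * (ellS A B C q r.1 r.2 x).ncard -
        χ ((QF A B C ((r.1 : ℤ), (r.2 : ℤ)) : ℤ) : ZMod q) * κ * x‖ ≤ 8 * √x := by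
    intro r hr
    simp at hr
    have := (hκ r.1 r.2 hr.2 x hx).2
    rw [mul_assoc, ← mul_sub, norm_mul]
    have h2 : ‖((ellS A B C q r.1 r.2 x).ncard : ℂ) - κ * x‖ ≤ 8 * √x := by
      rw [← Real.norm_eq_abs, ← Complex.norm_real] at this
      exact_mod_cast this
    calc _ ≤ 1 * (8 * √x) := by
          gcongr
          exact χ.norm_le_one _
      _ = _ := one_mul _
  refine (Finset.sum_le_card_nsmul _ _ _ this).trans (le_of_eq ?_)
  simp
  ring

lemma exists_reduced : ∀ (n : ℕ) (A B C : ℤ), A.toNat = n → 0 < A → 0 < 4 * A * C - B ^ 2 →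
    ∃ (A' B' C' : ℤ) (e : ℤ × ℤ ≃ ℤ × ℤ), 1 ≤ A' ∧ |B'| ≤ A' ∧ A' ≤ C' ∧
      ∀ p, QF A' B' C' (e p) = QF A B C p := by
  intro n
  induction n using Nat.strong_induction_on with
  | _ n ih =>
  intro A B C hAn hA hD
  obtain ⟨k, hk⟩ : ∃ k : ℤ, |B - 2 * A * k| ≤ A := by
    refine ⟨(B + A) / (2 * A), ?_⟩
    have h1 := Int.mul_ediv_add_emod (B + A) (2 * A)
    have h2 := Int.emod_nonneg (B + A) (by omega : 2 * A ≠ 0)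
    have h3 := Int.emod_lt_of_pos (B + A) (by omega : 0 < 2 * A)
    rw [abs_le]
    constructor <;> linarith
  let e1 : ℤ × ℤ ≃ ℤ × ℤ :=
    { toFun := fun p ↦ (p.1 + k * p.2, p.2)
      invFun := fun p ↦ (p.1 - k * p.2, p.2)
      left_inv := fun p ↦ by simp
      right_inv := fun p ↦ by simp }
  set B1 := B - 2 * A * k with hB1
  set C1 := C - B * k + A * k ^ 2 with hC1
  have hq1 : ∀ p, QF A B1 C1 (e1 p) = QF A B C p := by
    intro p; simp only [QF, e1, Equiv.coe_fn_mk, hB1, hC1]; ring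
  have hD1 : 0 < 4 * A * C1 - B1 ^ 2 := by
    have : 4 * A * C1 - B1 ^ 2 = 4 * A * C - B ^ 2 := by rw [hB1, hC1]; ring
    omega
  by_cases hAC : A ≤ C1
  · exact ⟨A, B1, C1, e1, hA, hk, hAC, hq1⟩
  · have hC0 : 0 < C1 := by
      by_contra h
      nlinarith [sq_nonneg B1]
    obtain ⟨A', B', C', e, h1, h2, h3, h4⟩ := ih C1.toNat (by omega) C1 B1 A rfl hC0 (by linarith)
    refine ⟨A', B', C', (e1.trans (Equiv.prodComm ℤ ℤ)).trans e, h1, h2, h3, ?_⟩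
    intro p
    simp only [Equiv.trans_apply]
    rw [h4, ← hq1 p]
    simp only [QF, Equiv.prodComm_apply, Prod.fst_swap, Prod.snd_swap]
    ring

lemma form_sum (A B C : ℤ) (hA : 0 < A) (hD : 0 < 4 * A * C - B ^ 2) (q : ℕ) [NeZero q]
    (χ : DirichletCharacter ℂ q) :
    ∃ κ : ℂ, ∀ x : ℝ, 1 ≤ x →
      ‖(∑ k ∈ Finset.Icc 1 ⌊x⌋₊, χ k * RQ A B C k) - κ * x‖ ≤ (8 * q ^ 2 + 1) * √x := by
  obtain ⟨A', B', C', e, h1, h2, h3, h4⟩ := exists_reduced _ A B C rfl hA hD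
  have hR : ∀ n, RQ A B C n = RQ A' B' C' n := by
    intro n
    refine Nat.card_congr (e.subtypeEquiv fun p ↦ ?_)
    rw [h4]
  simp only [hR]
  exact form_sum_reduced A' B' C' h1 h2 h3 q χ

end Heil

namespace Heil

/-- Coordinates on an imaginary quadratic field. -/
structure QD (d : ℤ) (K : Type) [Field K] [NumberField K] where
  fr : Module.finrank ℚ K = 2
  re : K → ℚ
  im : K → ℚ
  re_add : ∀ x y, re (x + y) = re x + re y
  im_add : ∀ x y, im (x + y) = im x + im y
  re_mul : ∀ x y, re (x * y) = re x * re y + d * (im x * im y)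
  im_mul : ∀ x y, im (x * y) = re x * im y + im x * re y
  re_int : ∀ n : ℤ, re n = n
  im_int : ∀ n : ℤ, im n = 0
  θ : NumberField.RingOfIntegers K
  θ_sq : θ ^ 2 = (d : NumberField.RingOfIntegers K)
  re_θ : re (algebraMap (NumberField.RingOfIntegers K) K θ) = 0
  im_θ : im (algebraMap (NumberField.RingOfIntegers K) K θ) = 1
  norm_eq : ∀ x, Algebra.norm ℚ x = re x ^ 2 - d * im x ^ 2
  integral : ∀ x : NumberField.RingOfIntegers K, ∃ u v : ℤ,
    2 * re (algebraMap (NumberField.RingOfIntegers K) K x) = u ∧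
    2 * im (algebraMap (NumberField.RingOfIntegers K) K x) = v

lemma int_of_isIntegral (r : ℚ) (h : IsIntegral ℤ r) : ∃ n : ℤ, (n : ℚ) = r := by
  obtain ⟨n, hn⟩ := IsIntegrallyClosed.isIntegral_iff.mp h
  exact ⟨n, by simpa using hn⟩

lemma rat_int_of_squarefree (d : ℤ) (hsq : Squarefree d) (y : ℚ) (n : ℤ) (h : d * y ^ 2 = n) :
    ∃ v : ℤ, y = v := by
  refine ⟨y.num, ?_⟩
  have hden : (y.den : ℤ) ≠ 0 := by exact_mod_cast y.den_nz
  have hden' : (y.den : ℚ) ≠ 0 := by exact_mod_cast y.den_nz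
  have h1 : d * y.num ^ 2 = n * y.den ^ 2 := by
    have h2 : (d : ℚ) * (y.num / y.den) ^ 2 = n := by rw [Rat.num_div_den]; exact h
    rw [div_pow, ← mul_div_assoc, div_eq_iff (by positivity)] at h2
    exact_mod_cast h2
  have hc : IsCoprime (y.den : ℤ) y.num := by
    rw [Int.isCoprime_iff_gcd_eq_one]
    have := y.reduced
    rw [Int.gcd_comm]
    simpa [Int.gcd, Nat.Coprime] using this
  have h3 : (y.den : ℤ) ^ 2 ∣ d := by
    have : (y.den : ℤ) ^ 2 ∣ d * y.num ^ 2 := ⟨n, by rw [h1]; ring⟩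
    exact (hc.pow (m := 2) (n := 2)).dvd_of_dvd_mul_right this
  have h4 : IsUnit (y.den : ℤ) := hsq _ (by rw [← sq]; exact h3)
  have h5 : y.den = 1 := by
    have := Int.isUnit_iff_natAbs_eq.mp h4
    simpa using this
  conv_lhs => rw [← Rat.num_div_den y, h5]
  simp

/-- the concrete imaginary quadratic field -/
abbrev QK (d : ℤ) := QuadraticAlgebra ℚ (d : ℚ) 0

instance factQK (d : ℤ) [h : Fact (d < 0)] : Fact (∀ r : ℚ, r ^ 2 ≠ (d : ℚ) + 0 * r) := by
  refine ⟨fun r hr ↦ ?_⟩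
  have h1 : (d : ℚ) < 0 := by exact_mod_cast h.out
  nlinarith [sq_nonneg r]

instance nfQK (d : ℤ) [h : Fact (d < 0)] : NumberField (QK d) where
  to_charZero := charZero_of_injective_algebraMap (algebraMap ℚ (QK d)).injective
  to_finiteDimensional := by
    have : Module.Finite ℚ (QK d) := inferInstance
    convert this

lemma exists_QD (d : ℤ) [hd : Fact (d < 0)] (hsq : Squarefree d) : Nonempty (QD d (QK d)) := by
  have hθ : IsIntegral ℤ (⟨0, 1⟩ : QK d) := by
    refine ⟨Polynomial.X ^ 2 - Polynomial.C d, Polynomial.monic_X_pow_sub_C d two_ne_zero, ?_⟩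
    rw [← Polynomial.aeval_def]
    simp only [map_sub, map_pow, Polynomial.aeval_X, Polynomial.aeval_C]
    ext <;> simp [sq]
  obtain ⟨t, ht⟩ : ∃ t : NumberField.RingOfIntegers (QK d),
      algebraMap (NumberField.RingOfIntegers (QK d)) (QK d) t = ⟨0, 1⟩ :=
    ⟨⟨_, hθ⟩, rfl⟩
  have hre : ∀ r : ℚ, (algebraMap ℚ (QK d) r).re = r := fun _ ↦ rfl
  have him : ∀ r : ℚ, (algebraMap ℚ (QK d) r).im = 0 := fun _ ↦ rfl
  have hstar : ∀ x : QK d, IsIntegral ℤ x → IsIntegral ℤ (star x) := by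
    intro x hx
    exact hx.map (starRingEnd (QK d)).toIntAlgHom
  refine ⟨⟨?_, QuadraticAlgebra.re, QuadraticAlgebra.im, ?_, ?_, ?_, ?_, ?_, ?_, t, ?_, ?_, ?_, ?_, ?_⟩⟩
  · convert QuadraticAlgebra.finrank_eq_two (R := ℚ) (d : ℚ) 0
  · intro x y; simp
  · intro x y; simp
  · intro x y; simp; ring
  · intro x y; simp
  · intro n; simp
  · intro n; simp
  · apply NumberField.RingOfIntegers.coe_injective
    rw [map_pow, map_intCast, ht]
    ext <;> simp [sq]
  · rw [ht]
  · rw [ht]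
  · intro x
    have := QuadraticAlgebra.det_toLinearMap_eq_norm x
    rw [Algebra.norm_apply]
    trans x.norm
    · rw [← this]
      congr 1
    · rw [QuadraticAlgebra.norm_def]; ring
  · rintro ⟨x, hx⟩
    have hx' : IsIntegral ℤ x := hx
    have h1 : IsIntegral ℤ (algebraMap ℚ (QK d) (2 * x.re)) := by
      have : algebraMap ℚ (QK d) (2 * x.re) = x + star x := by
        refine QuadraticAlgebra.ext ?_ ?_
        · rw [hre]; simp; ring
        · rw [him]; simp
      rw [this]; exact hx'.add (hstar x hx')
    have h2 : IsIntegral ℤ (algebraMap ℚ (QK d) (x.re ^ 2 - d * x.im ^ 2)) := by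
      have : algebraMap ℚ (QK d) (x.re ^ 2 - d * x.im ^ 2) = x * star x := by
        refine QuadraticAlgebra.ext ?_ ?_
        · rw [hre]; simp; ring
        · rw [him]; simp; ring
      rw [this]; exact hx'.mul (hstar x hx')
    rw [isIntegral_algebraMap_iff (algebraMap ℚ (QK d)).injective] at h1 h2
    obtain ⟨u, hu⟩ := int_of_isIntegral _ h1
    obtain ⟨n, hn⟩ := int_of_isIntegral _ h2
    obtain ⟨v, hv⟩ := rat_int_of_squarefree d hsq (2 * x.im) (u ^ 2 - 4 * n) (by
      push_cast; rw [hu, hn]; ring)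
    exact ⟨u, v, hu.symm, hv⟩

end Heil

namespace Heil

open NumberField Ideal

namespace QD

variable {d : ℤ} {K : Type} [Field K] [NumberField K]

/-- rational part -/
def R (S : QD d K) (x : 𝓞 K) : ℚ := S.re (algebraMap (𝓞 K) K x)
/-- irrational part -/
def I (S : QD d K) (x : 𝓞 K) : ℚ := S.im (algebraMap (𝓞 K) K x)

lemma R_add (S : QD d K) (x y) : S.R (x + y) = S.R x + S.R y := by simp [R, S.re_add]
lemma I_add (S : QD d K) (x y) : S.I (x + y) = S.I x + S.I y := by simp [I, S.im_add]
lemma R_mul (S : QD d K) (x y) : S.R (x * y) = S.R x * S.R y + d * (S.I x * S.I y) := by simp [R, I, S.re_mul]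
lemma I_mul (S : QD d K) (x y) : S.I (x * y) = S.R x * S.I y + S.I x * S.R y := by simp [R, I, S.im_mul]
lemma R_int (S : QD d K) (n : ℤ) : S.R n = n := by simp [R, S.re_int]
lemma I_int (S : QD d K) (n : ℤ) : S.I n = 0 := by simp [I, S.im_int]
lemma R_θ (S : QD d K) : S.R S.θ = 0 := S.re_θ
lemma I_θ (S : QD d K) : S.I S.θ = 1 := S.im_θ

lemma norm_int (S : QD d K) (x : 𝓞 K) : ((Algebra.norm ℤ x : ℤ) : ℚ) = S.R x ^ 2 - d * S.I x ^ 2 := by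
  rw [Algebra.coe_norm_int]
  exact S.norm_eq _

lemma norm_nonneg (S : QD d K) (hd : d < 0) (x : 𝓞 K) : 0 ≤ Algebra.norm ℤ x := by
  have h := S.norm_int x
  have hd' : (d : ℚ) < 0 := by exact_mod_cast hd
  have : (0 : ℚ) ≤ ((Algebra.norm ℤ x : ℤ) : ℚ) := by
    rw [h]; nlinarith [sq_nonneg (S.R x), sq_nonneg (S.I x)]
  exact_mod_cast this

lemma norm_lower (S : QD d K) (hd : d < 0) (x : 𝓞 K) (hx : S.I x ≠ 0) : -d ≤ 4 * Algebra.norm ℤ x := by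
  have h := S.norm_int x
  have hd' : (d : ℚ) < 0 := by exact_mod_cast hd
  obtain ⟨u, v, hu, hv⟩ := S.integral x
  have hv' : 2 * S.I x = v := hv
  have hv0 : v ≠ 0 := by
    rintro rfl
    simp at hv'
    exact hx hv'
  have h1 : (1 : ℚ) ≤ (v : ℚ) ^ 2 := by
    have : 1 ≤ v ^ 2 := by
      have := sq_pos_of_ne_zero (R := ℤ) hv0
      omega
    exact_mod_cast this
  have : (-d : ℚ) ≤ 4 * ((Algebra.norm ℤ x : ℤ) : ℚ) := by
    rw [h]
    rw [← hv'] at h1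
    nlinarith [sq_nonneg (S.R x)]
  exact_mod_cast this

lemma absNorm_span_nat (S : QD d K) (p : ℕ) : absNorm (span {(p : 𝓞 K)}) = p ^ 2 := by
  rw [absNorm_span_natCast, RingOfIntegers.rank, S.fr]

lemma I_of_mem_span (S : QD d K) (p : ℕ) (x : 𝓞 K) (hx : x ∈ span {(p : 𝓞 K)}) :
    ∃ v : ℤ, 2 * S.I x = p * v := by
  obtain ⟨y, rfl⟩ := mem_span_singleton'.mp hx
  obtain ⟨u, v, hu, hv⟩ := S.integral y
  refine ⟨v, ?_⟩
  have hv' : 2 * S.I y = v := hv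
  have : ((p : 𝓞 K)) = ((p : ℤ) : 𝓞 K) := by simp
  rw [I_mul, this, R_int, I_int, ← hv']
  push_cast; ring

lemma exists_sq_of_norm (S : QD d K) (p : ℕ) (hp : p.Prime) (J : Ideal (𝓞 K)) (hJ : absNorm J = p) :
    ∃ b : ℤ, (p : ℤ) ∣ b ^ 2 - d := by
  have hcard : Nat.card (𝓞 K ⧸ J) = p := by
    rw [← hJ]; rfl
  obtain ⟨b, hb⟩ : ∃ b : ℤ, S.θ - b ∈ J := by
    have : Fact p.Prime := ⟨hp⟩
    have hfin : Finite (𝓞 K ⧸ J) := Nat.finite_of_card_ne_zero (by rw [hcard]; exact hp.ne_zero)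
    have hp0 : (p : 𝓞 K ⧸ J) = 0 := by
      have := absNorm_mem J
      rw [hJ] at this
      rw [← map_natCast (Ideal.Quotient.mk J), Ideal.Quotient.eq_zero_iff_mem]
      exact this
    have hnt : Nontrivial (𝓞 K ⧸ J) := by
      rw [← Finite.one_lt_card_iff_nontrivial, hcard]; exact hp.one_lt
    have hch : CharP (𝓞 K ⧸ J) p := by
      obtain ⟨c, hc⟩ := CharP.exists (𝓞 K ⧸ J)
      have h1 : c ∣ p := (CharP.cast_eq_zero_iff (𝓞 K ⧸ J) c p).mp hp0
      rcases (Nat.dvd_prime hp).mp h1 with h2 | h2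
      · subst h2
        have := (CharP.cast_eq_zero_iff (𝓞 K ⧸ J) 1 1).mpr dvd_rfl
        rw [Nat.cast_one] at this
        exact absurd this one_ne_zero
      · rwa [h2] at hc
    have hinj : Function.Injective (ZMod.castHom (dvd_refl p) (𝓞 K ⧸ J)) :=
      RingHom.injective _
    have hbij : Function.Bijective (ZMod.castHom (dvd_refl p) (𝓞 K ⧸ J)) :=
      (Nat.bijective_iff_injective_and_card _).mpr ⟨hinj, by rw [hcard, Nat.card_zmod]⟩
    obtain ⟨z, hz⟩ := hbij.2 (Ideal.Quotient.mk J S.θ)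
    obtain ⟨b, rfl⟩ := ZMod.intCast_surjective z
    refine ⟨b, ?_⟩
    rw [← Ideal.Quotient.eq, ← hz]
    simp
  refine ⟨b, ?_⟩
  have h1 := absNorm_dvd_norm_of_mem hb
  have h2 : Algebra.norm ℤ (S.θ - b) = b ^ 2 - d := by
    have h := S.norm_int (S.θ - b)
    have h3 : S.θ - (b : 𝓞 K) = S.θ + ((-b : ℤ) : 𝓞 K) := by push_cast; ring
    rw [h3, R_add, I_add, R_int, I_int, R_θ, I_θ] at h
    rw [h3]
    have : ((Algebra.norm ℤ (S.θ + ((-b : ℤ) : 𝓞 K)) : ℤ) : ℚ) = ((b ^ 2 - d : ℤ) : ℚ) := by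
      rw [h]; push_cast; ring
    exact_mod_cast this
  rw [h2, hJ] at h1
  exact h1

lemma eq_of_dvd_of_absNorm_eq (P Q : Ideal (𝓞 K)) (h : P ∣ Q) (hN : absNorm P = absNorm Q)
    (h0 : absNorm P ≠ 0) : P = Q := by
  obtain ⟨c, rfl⟩ := h
  rw [_root_.map_mul] at hN
  have : absNorm c = 1 := by
    have : absNorm P * absNorm c = absNorm P * 1 := by rw [mul_one]; exact hN.symm
    exact Nat.eq_of_mul_eq_mul_left (Nat.pos_of_ne_zero h0) this
  rw [absNorm_eq_one_iff] at this
  rw [this, Ideal.mul_top]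

lemma exists_split (S : QD d K) (p : ℕ) (hp : p.Prime) (hp2 : p ≠ 2) (b : ℤ) (hb : (p : ℤ) ∣ b ^ 2 - d) :
    ∃ P P' : Ideal (𝓞 K), absNorm P = p ∧ absNorm P' = p ∧ P * P' = span {(p : 𝓞 K)} ∧
      (P = P' ↔ (p : ℤ) ∣ d) := by
  have hpint : Prime (p : ℤ) := Nat.prime_iff_prime_int.mp hp
  have hp2' : ¬ (p : ℤ) ∣ 2 := by
    intro h
    have : p ∣ 2 := by exact_mod_cast h
    exact hp2 ((Nat.prime_dvd_prime_iff_eq hp Nat.prime_two).mp this)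
  have hmul : ((b : 𝓞 K) + S.θ) * (b - S.θ) ∈ span {(p : 𝓞 K)} := by
    obtain ⟨c, hc⟩ := hb
    rw [mem_span_singleton]
    refine ⟨c, ?_⟩
    have h1 : ((b : 𝓞 K) + S.θ) * (b - S.θ) = ((b ^ 2 - d : ℤ) : 𝓞 K) := by
      push_cast; rw [← S.θ_sq]; ring
    rw [h1, hc]; push_cast; rfl
  have hneg : (b : 𝓞 K) - S.θ = b + ((-1 : ℤ) : 𝓞 K) * S.θ := by push_cast; ring
  have hnm : ∀ (x : 𝓞 K) (n : ℤ), S.I x = n → ¬ (p : ℤ) ∣ n → x ∉ span {(p : 𝓞 K)} := by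
    intro x n hx hn hmem
    obtain ⟨v, hv⟩ := S.I_of_mem_span p x hmem
    rw [hx] at hv
    have : 2 * n = p * v := by exact_mod_cast hv
    rcases hpint.dvd_or_dvd (⟨v, this⟩ : (p : ℤ) ∣ 2 * n) with h | h
    · exact hp2' h
    · exact hn h
  have hp1 : ¬ (p : ℤ) ∣ 1 := hpint.not_dvd_one
  have hp1' : ¬ (p : ℤ) ∣ -1 := by rwa [dvd_neg]
  have hI1 : S.I ((b : 𝓞 K) + S.θ) = (1 : ℤ) := by rw [I_add, I_int, I_θ]; simp
  have hI2 : S.I ((b : 𝓞 K) - S.θ) = (-1 : ℤ) := by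
    rw [hneg, I_add, I_mul, I_int, R_int, I_int, I_θ]; simp
  have hp0 : (p : 𝓞 K) ≠ 0 := by exact_mod_cast hp.ne_zero
  have hspan0 : span {(p : 𝓞 K)} ≠ ⊥ := by simpa using hp0
  have hNspan := S.absNorm_span_nat p
  have hspan1 : ¬ IsUnit (span {(p : 𝓞 K)}) := by
    rw [Ideal.isUnit_iff, ← absNorm_eq_one_iff, hNspan]
    simp [hp.ne_one]
  have hnotprime : ¬ (span {(p : 𝓞 K)}).IsPrime := by
    intro h
    rcases h.mem_or_mem hmul with h | h
    · exact hnm _ _ hI1 hp1 h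
    · exact hnm _ _ hI2 hp1' h
  have hnotirr : ¬ Irreducible (span {(p : 𝓞 K)}) := by
    intro h
    exact hnotprime (Ideal.isPrime_of_prime h.prime)
  rw [irreducible_iff] at hnotirr
  push Not at hnotirr
  obtain ⟨P, P', hPP, hP, hP'⟩ := hnotirr hspan1
  rw [Ideal.isUnit_iff, ← absNorm_eq_one_iff] at hP hP'
  have hN : absNorm P * absNorm P' = p ^ 2 := by rw [← _root_.map_mul, ← hPP, hNspan]
  have hNP : absNorm P = p ∧ absNorm P' = p := by
    rwa [hp.mul_eq_prime_sq_iff hP hP'] at hN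
  refine ⟨P, P', hNP.1, hNP.2, hPP.symm, ?_⟩
  have hPp : P.IsPrime := isPrime_of_irreducible_absNorm (by rw [hNP.1]; exact hp)
  have hPp' : P'.IsPrime := isPrime_of_irreducible_absNorm (by rw [hNP.2]; exact hp)
  have hle : span {(p : 𝓞 K)} ≤ P := by rw [hPP]; exact Ideal.mul_le_left
  have hle' : span {(p : 𝓞 K)} ≤ P' := by rw [hPP]; exact Ideal.mul_le_right
  constructor
  · intro h
    subst h
    have hsq : ∀ (x : 𝓞 K), x ∈ P → x ^ 2 ∈ span {(p : 𝓞 K)} := by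
      intro x hx; rw [hPP, sq]; exact Ideal.mul_mem_mul hx hx
    have key : (p : ℤ) ∣ 2 * b := by
      by_contra hcon
      rcases hPp.mem_or_mem (hle hmul) with h | h
      · refine hnm _ (2 * b) ?_ hcon (hsq _ h)
        rw [sq, I_mul, hI1, R_add, R_int, R_θ]; push_cast; ring
      · refine hnm _ (-(2 * b)) ?_ (by rwa [dvd_neg]) (hsq _ h)
        rw [sq, I_mul, hI2, hneg, R_add, R_mul, R_int, R_θ, R_int, I_int]; push_cast; ring
    have hpb : (p : ℤ) ∣ b := (hpint.dvd_or_dvd key).resolve_left hp2'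
    have := dvd_sub (dvd_pow hpb two_ne_zero) hb
    simpa using this
  · intro hpd
    by_contra hne
    have hθmem : ∀ Q : Ideal (𝓞 K), Q.IsPrime → span {(p : 𝓞 K)} ≤ Q → S.θ ∈ Q := by
      intro Q hQ hQle
      apply hQ.mem_of_pow_mem 2
      rw [S.θ_sq]
      apply hQle
      obtain ⟨c, rfl⟩ := hpd
      rw [mem_span_singleton]
      exact ⟨c, by push_cast; rfl⟩
    have hcop : P ⊔ P' = ⊤ := by
      have hmax : P.IsMaximal := hPp.isMaximal (by
        rintro rfl; rw [absNorm_bot] at hNP; exact hp.ne_zero hNP.1.symm)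
      have hmax' : P'.IsMaximal := hPp'.isMaximal (by
        rintro rfl; rw [absNorm_bot] at hNP; exact hp.ne_zero hNP.2.symm)
      exact hmax.coprime_of_ne hmax' hne
    have : S.θ ∈ span {(p : 𝓞 K)} := by
      rw [hPP, Ideal.mul_eq_inf_of_coprime hcop]
      exact ⟨hθmem P hPp hle, hθmem P' hPp' hle'⟩
    exact hnm _ 1 (by rw [I_θ]; simp) hp1 this

end QD

end Heil

namespace Heil

open NumberField Ideal

/-- number of ideals of norm `n` -/
noncomputable def rI (K : Type) [Field K] [NumberField K] (n : ℕ) : ℕ :=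
  Nat.card {J : Ideal (𝓞 K) // absNorm J = n}

section
variable {K : Type} [Field K] [NumberField K]

instance finite_norm (n : ℕ) : Finite {J : Ideal (𝓞 K) // absNorm J = n} :=
  (Ideal.finite_setOfPred_absNorm_eq (S := 𝓞 K) n).to_subtype

lemma rI_one : rI K 1 = 1 := by
  rw [rI, Nat.card_eq_one_iff_unique]
  refine ⟨⟨?_⟩, ⟨⟨⊤, by simp⟩⟩⟩
  rintro ⟨a, ha⟩ ⟨b, hb⟩
  rw [absNorm_eq_one_iff] at ha hb
  rw [Subtype.mk.injEq, ha, hb]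

lemma coprime_ideals (I J : Ideal (𝓞 K)) (m n : ℕ) (h : Nat.Coprime m n)
    (hm : (m : 𝓞 K) ∈ I) (hn : (n : 𝓞 K) ∈ J) : I ⊔ J = ⊤ := by
  rw [Ideal.eq_top_iff_one]
  have h1 : IsCoprime (m : ℤ) (n : ℤ) := Nat.isCoprime_iff_coprime.mpr h
  obtain ⟨a, b, hab⟩ := h1
  have h2 : (1 : 𝓞 K) = (a : 𝓞 K) * m + b * n := by exact_mod_cast congrArg (Int.cast (R := 𝓞 K)) hab.symm
  rw [h2]
  exact Ideal.add_mem _ (Ideal.mem_sup_left (I.mul_mem_left _ hm))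
    (Ideal.mem_sup_right (J.mul_mem_left _ hn))

lemma mem_of_norm (I : Ideal (𝓞 K)) (m : ℕ) (h : absNorm I = m) : (m : 𝓞 K) ∈ I := by
  rw [← h]; exact absNorm_mem I

lemma coprime_absNorm (I : Ideal (𝓞 K)) (m n : ℕ) (hm : (m : 𝓞 K) ∈ I) (h : Nat.Coprime m n) :
    Nat.Coprime (absNorm I) n := by
  have h1 : span {(m : 𝓞 K)} ≤ I := by rwa [span_singleton_le_iff_mem]
  have h2 := absNorm_dvd_absNorm_of_le h1
  rw [absNorm_span_natCast] at h2
  exact Nat.Coprime.coprime_dvd_left h2 (h.pow_left _)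

lemma rI_mul (m n : ℕ) (hm : m ≠ 0) (hn : n ≠ 0) (h : Nat.Coprime m n) :
    rI K (m * n) = rI K m * rI K n := by
  rw [rI, rI, rI, ← Nat.card_prod]
  symm
  let f : {J : Ideal (𝓞 K) // absNorm J = m} × {J : Ideal (𝓞 K) // absNorm J = n} →
      {J : Ideal (𝓞 K) // absNorm J = m * n} :=
    fun p ↦ ⟨p.1.1 * p.2.1, by rw [_root_.map_mul, p.1.2, p.2.2]⟩
  refine Nat.card_congr (Equiv.ofBijective f ⟨?_, ?_⟩)
  · rintro ⟨⟨I, hI⟩, ⟨J, hJ⟩⟩ ⟨⟨I', hI'⟩, ⟨J', hJ'⟩⟩ heq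
    simp only [f, Subtype.mk.injEq] at heq
    have hc1 : IsCoprime I J' := by
      rw [Ideal.isCoprime_iff_sup_eq]
      exact coprime_ideals I J' m n h (mem_of_norm I m hI) (mem_of_norm J' n hJ')
    have hc2 : IsCoprime J I' := by
      rw [Ideal.isCoprime_iff_sup_eq]
      exact coprime_ideals J I' n m h.symm (mem_of_norm J n hJ) (mem_of_norm I' m hI')
    have h1 : I ∣ I' := hc1.dvd_of_dvd_mul_right (heq ▸ dvd_mul_right I J)
    have h2 : J ∣ J' := hc2.dvd_of_dvd_mul_left (heq ▸ dvd_mul_left J I)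
    have e1 := QD.eq_of_dvd_of_absNorm_eq I I' h1 (by rw [hI, hI']) (by rwa [hI])
    have e2 := QD.eq_of_dvd_of_absNorm_eq J J' h2 (by rw [hJ, hJ']) (by rwa [hJ])
    subst e1 e2
    rfl
  · rintro ⟨L, hL⟩
    set I := L ⊔ span {(m : 𝓞 K)} with hI
    set J := L ⊔ span {(n : 𝓞 K)} with hJ
    have hmI : (m : 𝓞 K) ∈ I := Ideal.mem_sup_right (mem_span_singleton_self _)
    have hnJ : (n : 𝓞 K) ∈ J := Ideal.mem_sup_right (mem_span_singleton_self _)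
    have hIJ := coprime_ideals I J m n h hmI hnJ
    have hprod : I * J = L := by
      apply le_antisymm
      · rw [hI, hJ, Ideal.sup_mul, Ideal.mul_sup, Ideal.mul_sup]
        refine sup_le (sup_le Ideal.mul_le_left Ideal.mul_le_left) (sup_le Ideal.mul_le_right ?_)
        rw [span_singleton_mul_span_singleton, span_singleton_le_iff_mem]
        have := mem_of_norm L (m * n) hL
        exact_mod_cast this
      · rw [Ideal.mul_eq_inf_of_coprime hIJ]
        exact le_inf le_sup_left le_sup_left
    have hN : absNorm I * absNorm J = m * n := by rw [← _root_.map_mul, hprod, hL]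
    have hcI := coprime_absNorm I m n hmI h
    have hcJ := coprime_absNorm J n m hnJ h.symm
    have hdI : absNorm I ∣ m := hcI.dvd_of_dvd_mul_right (Dvd.intro _ hN)
    have hdJ : absNorm J ∣ n := hcJ.dvd_of_dvd_mul_left (Dvd.intro_left _ hN)
    have hnI : absNorm I = m := by
      apply Nat.le_antisymm (Nat.le_of_dvd (Nat.pos_of_ne_zero hm) hdI)
      by_contra hlt
      push Not at hlt
      have h1 := Nat.le_of_dvd (Nat.pos_of_ne_zero hn) hdJ
      have h2 : absNorm I * absNorm J < m * n :=
        Nat.mul_lt_mul_of_lt_of_le hlt h1 (Nat.pos_of_ne_zero hn)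
      omega
    have hnJ : absNorm J = n := by
      rw [hnI] at hN
      exact Nat.eq_of_mul_eq_mul_left (Nat.pos_of_ne_zero hm) hN
    exact ⟨⟨⟨I, hnI⟩, ⟨J, hnJ⟩⟩, Subtype.ext hprod⟩

lemma exists_prime_factor (p : ℕ) (hp : p.Prime) (J : Ideal (𝓞 K)) (k : ℕ)
    (hJ : absNorm J = p ^ (k + 1)) :
    ∃ Q : Ideal (𝓞 K), Prime Q ∧ Q ∣ J ∧ Q ∣ span {(p : 𝓞 K)} := by
  obtain ⟨Q, hQ, hQp, hQJ⟩ := exists_isMaximal_dvd_of_dvd_absNorm' hp J (by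
    rw [hJ]; exact dvd_pow_self p (by omega))
  have hmem : (p : 𝓞 K) ∈ Q := by
    have : (p : ℤ) ∈ Q.under ℤ := by rw [hQp]; exact mem_span_singleton_self _
    rw [Ideal.mem_comap] at this
    simpa using this
  have hp0 : (p : 𝓞 K) ≠ 0 := by exact_mod_cast hp.ne_zero
  have hQ0 : Q ≠ ⊥ := by
    rintro rfl
    exact hp0 (by simpa using hmem)
  refine ⟨Q, Ideal.prime_of_isPrime hQ0 hQ.isPrime, hQJ, ?_⟩
  rw [Ideal.dvd_span_singleton]; exact hmem

lemma inert_struct {d : ℤ} (S : QD d K) (p : ℕ) (hp : p.Prime)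
    (hin : ∀ J : Ideal (𝓞 K), absNorm J ≠ p) :
    ∀ (k : ℕ) (J : Ideal (𝓞 K)), absNorm J = p ^ k →
      ∃ j, k = 2 * j ∧ J = span {(p : 𝓞 K)} ^ j := by
  intro k
  induction k using Nat.strong_induction_on with
  | _ k ih =>
  intro J hJ
  rcases Nat.eq_zero_or_pos k with rfl | hk
  · refine ⟨0, rfl, ?_⟩
    rw [pow_zero, absNorm_eq_one_iff] at hJ
    rw [hJ, pow_zero, Ideal.one_eq_top]
  · obtain ⟨k, rfl⟩ : ∃ k', k = k' + 1 := ⟨k - 1, by omega⟩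
    obtain ⟨Q, hQ, hQJ, hQp⟩ := exists_prime_factor p hp J k hJ
    have hN := map_dvd absNorm hQp
    rw [S.absNorm_span_nat, Nat.dvd_prime_pow hp] at hN
    obtain ⟨i, hi, hNi⟩ := hN
    have hi2 : i = 2 := by
      interval_cases i
      · rw [pow_zero, absNorm_eq_one_iff] at hNi
        exact absurd hQ.not_isUnit (by rw [not_not, Ideal.isUnit_iff]; exact hNi)
      · exact absurd (by simpa using hNi) (hin Q)
      · rfl
    subst hi2
    have hQeq := QD.eq_of_dvd_of_absNorm_eq Q _ hQp (by rw [S.absNorm_span_nat, hNi])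
      (by rw [hNi]; exact pow_ne_zero _ hp.ne_zero)
    obtain ⟨J', rfl⟩ := hQJ
    rw [_root_.map_mul, hNi] at hJ
    have hk2 : 1 ≤ k := by
      by_contra h
      have : k = 0 := by omega
      subst this
      have h1 : p ^ 2 ∣ p ^ 1 := by rw [← show 0 + 1 = 1 from rfl, ← hJ]; exact dvd_mul_right _ _
      have := (Nat.pow_dvd_pow_iff_le_right hp.one_lt).mp h1
      omega
    obtain ⟨k, rfl⟩ : ∃ k', k = k' + 1 := ⟨k - 1, by omega⟩
    have hJ' : absNorm J' = p ^ k := by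
      have : p ^ 2 * absNorm J' = p ^ 2 * p ^ k := by rw [hJ]; ring
      exact Nat.eq_of_mul_eq_mul_left (pow_pos hp.pos 2) this
    obtain ⟨j, rfl, hj⟩ := ih k (by omega) J' hJ'
    exact ⟨j + 1, by ring, by rw [hj, hQeq, pow_succ']⟩

lemma split_struct (p : ℕ) (hp : p.Prime) (P P' : Ideal (𝓞 K)) (hP : absNorm P = p)
    (hP' : absNorm P' = p) (hPP : P * P' = span {(p : 𝓞 K)}) :
    ∀ (k : ℕ) (J : Ideal (𝓞 K)), absNorm J = p ^ k → ∃ i ≤ k, J = P ^ i * P' ^ (k - i) := by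
  have hPi : Irreducible P := irreducible_of_irreducible_absNorm (by rw [hP]; exact hp)
  have hPi' : Irreducible P' := irreducible_of_irreducible_absNorm (by rw [hP']; exact hp)
  intro k
  induction k with
  | zero =>
    intro J hJ
    refine ⟨0, le_rfl, ?_⟩
    rw [pow_zero, absNorm_eq_one_iff] at hJ
    rw [hJ]; simp
  | succ k ih =>
    intro J hJ
    obtain ⟨Q, hQ, hQJ, hQp⟩ := exists_prime_factor p hp J k hJ
    rw [← hPP] at hQp
    obtain ⟨J', rfl⟩ := hQJ
    have hJ' : absNorm Q = p → absNorm J' = p ^ k := by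
      intro h
      rw [_root_.map_mul, h, pow_succ'] at hJ
      exact Nat.eq_of_mul_eq_mul_left hp.pos hJ
    rcases hQ.dvd_or_dvd hQp with h | h
    · have hQP : Q = P := associated_iff_eq.mp (hQ.irreducible.associated_of_dvd hPi h)
      subst hQP
      obtain ⟨i, hi, hJi⟩ := ih J' (hJ' hP)
      refine ⟨i + 1, by omega, ?_⟩
      rw [hJi, show k + 1 - (i + 1) = k - i by omega, pow_succ']; ring
    · have hQP : Q = P' := associated_iff_eq.mp (hQ.irreducible.associated_of_dvd hPi' h)
      subst hQP
      obtain ⟨i, hi, hJi⟩ := ih J' (hJ' hP')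
      refine ⟨i, by omega, ?_⟩
      rw [hJi, show k + 1 - i = (k - i) + 1 by omega, pow_succ']; ring

lemma rI_prime_pow {d : ℤ} (S : QD d K) (p : ℕ) (hp : p.Prime) (hp2 : p ≠ 2) (k : ℕ) :
    (rI K (p ^ k) : ℤ) = ∑ i ∈ Finset.range (k + 1), (jacobiSym d p) ^ i := by
  have : Fact p.Prime := ⟨hp⟩
  rw [← jacobiSym.legendreSym.to_jacobiSym]
  have hsq : (∃ b : ℤ, (p : ℤ) ∣ b ^ 2 - d) ↔ IsSquare (d : ZMod p) := by
    constructor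
    · rintro ⟨b, hb⟩
      refine ⟨(b : ZMod p), ?_⟩
      have := (ZMod.intCast_zmod_eq_zero_iff_dvd (b ^ 2 - d) p).mpr hb
      push_cast at this
      rw [← sq]; exact (sub_eq_zero.mp this).symm
    · rintro ⟨z, hz⟩
      obtain ⟨b, rfl⟩ := ZMod.intCast_surjective z
      refine ⟨b, ?_⟩
      rw [← ZMod.intCast_zmod_eq_zero_iff_dvd]
      push_cast
      rw [hz]; ring
  by_cases hb : ∃ b : ℤ, (p : ℤ) ∣ b ^ 2 - d
  · have hb' := hb
    obtain ⟨b, hbd⟩ := hb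
    obtain ⟨P, P', hP, hP', hPP, hiff⟩ := S.exists_split p hp hp2 b hbd
    have hst := split_struct p hp P P' hP hP' hPP k
    by_cases hpd : (p : ℤ) ∣ d
    · have h0 : legendreSym p d = 0 := by
        rw [legendreSym.eq_zero_iff, ZMod.intCast_zmod_eq_zero_iff_dvd]; exact hpd
      rw [h0, Finset.sum_range_succ']
      simp only [pow_zero, ne_eq, Nat.add_eq_zero_iff, one_ne_zero, and_false, not_false_eq_true,
        zero_pow, Finset.sum_const_zero, zero_add]
      obtain rfl := hiff.mpr hpd
      have : rI K (p ^ k) = 1 := by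
        rw [rI, Nat.card_eq_one_iff_unique]
        refine ⟨⟨?_⟩, ⟨⟨P ^ k, by rw [map_pow, hP]⟩⟩⟩
        rintro ⟨a, ha⟩ ⟨b, hb⟩
        obtain ⟨i, hi, rfl⟩ := hst a ha
        obtain ⟨j, hj, rfl⟩ := hst b hb
        rw [Subtype.mk.injEq, ← pow_add, ← pow_add]; congr 1; omega
      rw [this]; simp
    · have h1 : legendreSym p d = 1 := by
        rw [legendreSym.eq_one_iff p (by rwa [Ne, ZMod.intCast_zmod_eq_zero_iff_dvd])]
        exact hsq.mp hb'
      rw [h1]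
      simp only [one_pow, Finset.sum_const, Finset.card_range, nsmul_eq_mul, mul_one]
      have hne : P ≠ P' := fun h ↦ hpd (hiff.mp h)
      have hPi : Prime P := (irreducible_of_irreducible_absNorm (by rw [hP]; exact hp)).prime
      have hPi' : Prime P' := (irreducible_of_irreducible_absNorm (by rw [hP']; exact hp)).prime
      have hinj : ∀ i j, i < j → j ≤ k → P ^ i * P' ^ (k - i) ≠ P ^ j * P' ^ (k - j) := by
        intro i j hij hjk h
        have e1 : P ^ j = P ^ i * P ^ (j - i) := by rw [← pow_add]; congr 1; omega
        have e2 : P' ^ (k - i) = P' ^ (k - j) * P' ^ (j - i) := by rw [← pow_add]; congr 1; omega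
        rw [e1, e2, mul_assoc] at h
        have h2 := mul_left_cancel₀ (pow_ne_zero i hPi.ne_zero) h
        rw [mul_comm (P ^ (j - i))] at h2
        have h3 := mul_left_cancel₀ (pow_ne_zero _ hPi'.ne_zero) h2
        have h4 : P ∣ P' ^ (j - i) := by rw [h3]; exact dvd_pow_self P (by omega)
        have h5 := hPi.dvd_of_dvd_pow h4
        exact hne (associated_iff_eq.mp (hPi.irreducible.associated_of_dvd hPi'.irreducible h5))
      let f : Fin (k + 1) → {J : Ideal (𝓞 K) // absNorm J = p ^ k} := fun i ↦
        ⟨P ^ (i : ℕ) * P' ^ (k - i), by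
          rw [_root_.map_mul, map_pow, map_pow, hP, hP', ← pow_add]; congr 1; omega⟩
      have hf : Function.Bijective f := by
        constructor
        · intro i j hij
          simp only [f, Subtype.mk.injEq] at hij
          by_contra hne
          rcases lt_or_gt_of_ne (fun h ↦ hne (Fin.ext h) : (i : ℕ) ≠ j) with h | h
          · exact hinj i j h (by omega) hij
          · exact hinj j i h (by omega) hij.symm
        · rintro ⟨J, hJ⟩
          obtain ⟨i, hi, rfl⟩ := hst J hJ
          exact ⟨⟨i, by omega⟩, rfl⟩
      have : rI K (p ^ k) = k + 1 := by
        rw [rI, ← Nat.card_congr (Equiv.ofBijective f hf), Nat.card_fin]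
      rw [this]
  · have h1 : legendreSym p d = -1 := by
      rw [legendreSym.eq_neg_one_iff]
      rwa [← hsq]
    have hin : ∀ J : Ideal (𝓞 K), absNorm J ≠ p := fun J hJ ↦ hb (S.exists_sq_of_norm p hp J hJ)
    have hst := inert_struct S p hp hin k
    rw [h1, neg_one_geom_sum]
    by_cases hk : Even k
    · rw [if_neg (by rw [Nat.not_even_iff_odd]; exact hk.add_one)]
      obtain ⟨j, hj⟩ := hk
      have : rI K (p ^ k) = 1 := by
        rw [rI, Nat.card_eq_one_iff_unique]
        refine ⟨⟨?_⟩, ⟨⟨span {(p : 𝓞 K)} ^ j, ?_⟩⟩⟩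
        · rintro ⟨a, ha⟩ ⟨b, hb⟩
          obtain ⟨i, hi, rfl⟩ := hst a ha
          obtain ⟨j, hj, rfl⟩ := hst b hb
          rw [Subtype.mk.injEq]; congr 1; omega
        · rw [map_pow, S.absNorm_span_nat, ← pow_mul]; congr 1; omega
      rw [this]; simp
    · rw [if_pos (by rw [Nat.not_even_iff_odd] at hk; exact hk.add_one)]
      have : rI K (p ^ k) = 0 := by
        rw [rI, Nat.card_eq_zero]
        left
        refine ⟨fun ⟨J, hJ⟩ ↦ ?_⟩
        obtain ⟨j, rfl, _⟩ := hst J hJ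
        exact hk (even_two_mul j)
      rw [this]; simp

end

end Heil

namespace Heil

section
variable {K : Type} [Field K] [NumberField K]

lemma jac_sum_mul (d : ℤ) (a b : ℕ) (hab : Nat.Coprime a b) :
    ∑ m ∈ (a * b).divisors, jacobiSym d m =
      (∑ m ∈ a.divisors, jacobiSym d m) * ∑ m ∈ b.divisors, jacobiSym d m := by
  let f : ArithmeticFunction ℤ := ⟨fun n => if n = 0 then 0 else jacobiSym d n, by simp⟩
  have hf : f.IsMultiplicative := by
    refine ArithmeticFunction.IsMultiplicative.iff_ne_zero.mpr ⟨?_, ?_⟩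
    · simp [f]
    · intro m n hm hn _
      simp [f, hm, hn, jacobiSym.mul_right' d hm hn]
  have hg := hf.mul ArithmeticFunction.isMultiplicative_zeta.natCast
  have key : ∀ n : ℕ, (f * (ArithmeticFunction.zeta : ArithmeticFunction ℤ)) n = ∑ m ∈ n.divisors, jacobiSym d m := by
    intro n
    rw [ArithmeticFunction.coe_mul_zeta_apply]
    refine Finset.sum_congr rfl fun m hm => ?_
    have : m ≠ 0 := (Nat.pos_of_mem_divisors hm).ne'
    simp [f, this]
  rw [← key, ← key, ← key]
  exact hg.map_mul_of_coprime hab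

lemma rI_odd {d : ℤ} (S : QD d K) (n : ℕ) (hn : Odd n) :
    (rI K n : ℤ) = ∑ m ∈ n.divisors, jacobiSym d m := by
  induction n using Nat.recOnPosPrimePosCoprime with
  | zero => simp at hn
  | one => simp [rI_one]
  | prime_pow p k hp hk =>
    have hp2 : p ≠ 2 := by
      rintro rfl
      exact absurd hn (by simp [Nat.not_odd_iff_even, Nat.even_pow, hk.ne'])
    rw [rI_prime_pow S p hp hp2, Nat.divisors_prime_pow hp, Finset.sum_map]
    simp [jacobiSym.pow_right]
  | coprime a b ha hb hab iha ihb =>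
    rw [Nat.odd_mul] at hn
    rw [rI_mul a b (by omega) (by omega) hab, jac_sum_mul d a b hab]
    push_cast
    rw [iha hn.1, ihb hn.2]

open scoped Classical in
lemma rI_inert {d : ℤ} (S : QD d K) (n : ℕ) (hn : Odd n)
    (h : ∀ p, p.Prime → p ∣ n → rI K p = 0) :
    rI K n = if IsSquare n then 1 else 0 := by
  induction n using Nat.recOnPosPrimePosCoprime with
  | zero => simp at hn
  | one => simp [rI_one]
  | prime_pow p k hp hk =>
    have hp2 : p ≠ 2 := by
      rintro rfl
      exact absurd hn (by simp [Nat.not_odd_iff_even, Nat.even_pow, hk.ne'])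
    have h1 := rI_prime_pow S p hp hp2 1
    rw [pow_one, h p hp (dvd_pow_self p hk.ne')] at h1
    simp [Finset.sum_range_succ] at h1
    have h2 : jacobiSym d p = -1 := by linarith
    have h3 := rI_prime_pow S p hp hp2 k
    rw [h2, neg_one_geom_sum] at h3
    have h4 : IsSquare (p ^ k) ↔ Even k := by
      constructor
      · rintro ⟨r, hr⟩
        have hd : r ∣ p ^ k := ⟨r, hr⟩
        obtain ⟨j, hj, rfl⟩ := (Nat.dvd_prime_pow hp).mp hd
        rw [← pow_add] at hr
        exact ⟨j, Nat.pow_right_injective hp.two_le hr⟩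
      · exact fun h => h.isSquare_pow p
    rw [if_congr h4 rfl rfl]
    by_cases hk2 : Even k
    · rw [if_neg (by simpa [Nat.even_add_one] using hk2)] at h3
      simp only [hk2, if_true]; exact_mod_cast h3
    · rw [if_pos (by simpa [Nat.even_add_one] using hk2)] at h3
      simp only [hk2, if_false]; exact_mod_cast h3
  | coprime a b ha hb hab iha ihb =>
    rw [Nat.odd_mul] at hn
    rw [rI_mul a b (by omega) (by omega) hab, iha hn.1 (fun p hp hpa => h p hp (hpa.mul_right b)),
      ihb hn.2 (fun p hp hpa => h p hp (hpa.mul_left a))]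
    have h4 : IsSquare (a * b) ↔ IsSquare a ∧ IsSquare b := by
      constructor
      · rintro ⟨r, hr⟩
        rw [← sq] at hr
        have hu : IsUnit (gcd a b) := by rw [Nat.isUnit_iff]; exact hab
        have hu' : IsUnit (gcd b a) := by rw [Nat.isUnit_iff]; exact hab.symm
        obtain ⟨s, hs⟩ := exists_eq_pow_of_mul_eq_pow hu hr
        obtain ⟨t, ht⟩ := exists_eq_pow_of_mul_eq_pow hu' (by rw [mul_comm]; exact hr)
        exact ⟨⟨s, by rw [hs, sq]⟩, ⟨t, by rw [ht, sq]⟩⟩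
      · rintro ⟨h1, h2⟩
        exact h1.mul h2
    by_cases h5 : IsSquare a <;> by_cases h6 : IsSquare b <;> simp [h4, h5, h6]

end

/-- the Jacobi symbol at odd arguments, zero at even ones -/
noncomputable def jacFun (d : ℤ) (n : ℕ) : ℂ := if Odd n then (jacobiSym d n : ℂ) else 0

lemma jacFun_mod (d : ℤ) (n : ℕ) : jacFun d (n % (4 * d.natAbs)) = jacFun d n := by
  have h1 : Odd (n % (4 * d.natAbs)) ↔ Odd n := by
    have h2 : n % (4 * d.natAbs) % 2 = n % 2 := Nat.mod_mod_of_dvd _ ⟨2 * d.natAbs, by ring⟩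
    rw [Nat.odd_iff, Nat.odd_iff, h2]
  unfold jacFun
  by_cases hn : Odd n
  · rw [if_pos hn, if_pos (h1.mpr hn), jacobiSym.mod_right d hn]
  · rw [if_neg hn, if_neg (fun h => hn (h1.mp h))]

lemma jacFun_mul (d : ℤ) (m n : ℕ) : jacFun d (m * n) = jacFun d m * jacFun d n := by
  unfold jacFun
  by_cases hm : Odd m
  · by_cases hn : Odd n
    · rw [if_pos hm, if_pos hn, if_pos (hm.mul hn),
        jacobiSym.mul_right' d (by rintro rfl; simp at hm) (by rintro rfl; simp at hn)]
      push_cast; rfl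
    · rw [if_neg hn, if_neg (by rw [Nat.odd_mul]; tauto), mul_zero]
  · rw [if_neg hm, if_neg (by rw [Nat.odd_mul]; tauto), zero_mul]

lemma exists_jacChar (d : ℤ) [NeZero (4 * d.natAbs)] :
    ∃ ψ : DirichletCharacter ℂ (4 * d.natAbs), ∀ n : ℕ, Odd n → ψ n = (jacobiSym d n : ℂ) := by
  refine ⟨{ toFun := fun z => jacFun d z.val, map_one' := ?_, map_mul' := ?_, map_nonunit' := ?_ }, ?_⟩
  · have := ZMod.val_natCast (4 * d.natAbs) 1
    rw [Nat.cast_one] at this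
    rw [this, jacFun_mod d]
    simp [jacFun]
  · intro x y
    rw [ZMod.val_mul, jacFun_mod d, jacFun_mul]
  · intro z hz
    by_contra hne
    apply hz
    change jacFun d z.val ≠ 0 at hne
    unfold jacFun at hne
    have ho : Odd z.val := by
      by_contra h; simp [h] at hne
    rw [if_pos ho] at hne
    have h2 : jacobiSym d z.val ≠ 0 := by exact_mod_cast hne
    rw [Ne, jacobiSym.eq_zero_iff] at h2
    have h3 : d.gcd z.val = 1 := by
      by_contra h
      exact h2 ⟨by rintro h0; rw [h0] at ho; simp at ho, h⟩
    rw [← ZMod.natCast_zmod_val z, ZMod.isUnit_iff_coprime]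
    refine Nat.Coprime.mul_right ?_ ?_
    · exact (Nat.Coprime.pow_right 2 ho.coprime_two_right)
    · rw [Nat.coprime_comm]; exact h3
  · intro n hn
    change jacFun d (n : ZMod (4 * d.natAbs)).val = _
    rw [ZMod.val_natCast, jacFun_mod d, jacFun, if_pos hn]

end Heil

namespace Heil

open NumberField Ideal

variable {K : Type} [Field K] [NumberField K]

/-- few small split primes -/
lemma few_primes {d : ℤ} (S : QD d K) (hd : d < 0) (T : Finset ℕ) (x : ℕ)
    (hT : ∀ p ∈ T, p.Prime ∧ p ≤ x ∧ rI K p ≠ 0) (hx : 1 ≤ x)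
    (hcard : NumberField.classNumber K ≤ T.card) : -d ≤ 4 * (x : ℤ) ^ T.card := by
  classical
  have hP : ∀ p : ℕ, ∃ P : Ideal (𝓞 K), P ≠ 0 ∧ (p ∈ T → absNorm P = p) := by
    intro p
    by_cases hp : p ∈ T
    · obtain ⟨J, hJ⟩ := (Nat.card_ne_zero.mp (hT p hp).2.2).1
      refine ⟨J, ?_, fun _ => hJ⟩
      rintro rfl
      rw [Ideal.zero_eq_bot, absNorm_bot] at hJ
      exact (hT p hp).1.ne_zero hJ.symm
    · exact ⟨1, one_ne_zero, fun h => absurd h hp⟩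
  choose P hP0 hPn using hP
  -- list of primes
  let l := T.toList
  have hlen : l.length = T.card := by simp [l]
  let c : ℕ → ClassGroup (𝓞 K) := fun p => ClassGroup.mk0 ⟨P p, mem_nonZeroDivisors_of_ne_zero (hP0 p)⟩
  have hpig : ∃ i j, i < j ∧ j ≤ T.card ∧ ((l.take i).map c).prod = ((l.take j).map c).prod := by
    have : ∃ a b : Fin (T.card + 1), a ≠ b ∧ ((l.take a).map c).prod = ((l.take b).map c).prod := by
      apply Fintype.exists_ne_map_eq_of_card_lt
      rw [Fintype.card_fin]
      unfold NumberField.classNumber at hcard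
      omega
    obtain ⟨a, b, hab, h⟩ := this
    rcases lt_or_gt_of_ne hab with h1 | h1
    · exact ⟨a, b, h1, by omega, h⟩
    · exact ⟨b, a, h1, by omega, h.symm⟩
  obtain ⟨i, j, hij, hj, heq⟩ := hpig
  let m := (l.take j).drop i
  have hm1 : (m.map c).prod = 1 := by
    have : l.take j = l.take i ++ m := by
      have h5 := (List.take_append_drop i (l.take j)).symm
      rwa [List.take_take, min_eq_left hij.le] at h5
    rw [this, List.map_append, List.prod_append] at heq
    exact (mul_eq_left.mp heq.symm)
  have hml : m.length = j - i := by simp [m, hlen]; omega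
  have hmT : ∀ p ∈ m, p ∈ T := by
    intro p hp
    have := List.mem_of_mem_take (List.mem_of_mem_drop hp)
    simpa [l] using this
  have hnd : m.Nodup := by
    exact ((Finset.nodup_toList T).sublist (List.take_sublist _ _)).sublist (List.drop_sublist _ _)
  have hcl : ∀ L : List ℕ, ∃ h0 : (L.map P).prod ≠ 0, (L.map c).prod = ClassGroup.mk0 ⟨(L.map P).prod, mem_nonZeroDivisors_of_ne_zero h0⟩ := by
    intro L
    induction L with
    | nil => exact ⟨by simp, (_root_.map_one (ClassGroup.mk0 (R := 𝓞 K))).symm⟩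
    | cons p L ih =>
      obtain ⟨h0, h⟩ := ih
      refine ⟨by simp only [List.map_cons, List.prod_cons]; exact mul_ne_zero (hP0 p) h0, ?_⟩
      rw [List.map_cons, List.prod_cons, h]
      simp only [c]
      rw [← _root_.map_mul]
      rfl
  obtain ⟨h0, hc⟩ := hcl m
  rw [hm1] at hc
  have hpr := (ClassGroup.mk0_eq_one_iff _).mp hc.symm
  obtain ⟨α, hα⟩ := hpr.principal
  change (m.map P).prod = span {α} at hα
  have hN : absNorm (m.map P).prod = m.prod := by
    rw [map_list_prod, List.map_map]
    congr 1
    conv_rhs => rw [← List.map_id m]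
    exact List.map_congr_left fun p hp => hPn p (hmT p hp)
  have hNα : Algebra.norm ℤ α = (m.prod : ℤ) := by
    rw [← hN, hα, absNorm_span_singleton]
    exact (Int.natAbs_of_nonneg (S.norm_nonneg hd α)).symm
  have hmp : ∀ p ∈ m, p.Prime := fun p hp => (hT p (hmT p hp)).1
  have hm0 : m.prod ≠ 0 := by
    intro h
    rw [List.prod_eq_zero_iff] at h
    exact (hmp 0 h).ne_zero rfl
  have hsqf : Squarefree m.prod := by
    rw [Nat.squarefree_iff_nodup_primeFactorsList hm0]
    exact (Nat.primeFactorsList_unique rfl hmp).nodup hnd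
  have hgt : m.prod ≠ 1 := by
    intro h
    have hne : 0 < m.length := by omega
    have hmem := List.getElem_mem hne
    have h2 := List.dvd_prod hmem
    rw [h] at h2
    exact (hmp _ hmem).one_lt.ne' (Nat.dvd_one.mp h2)
  have hI : S.I α ≠ 0 := by
    intro hI
    have h1 := S.norm_int α
    rw [hI, hNα] at h1
    have h2 : IsSquare ((m.prod : ℕ) : ℚ) := ⟨S.R α, by rw [← Int.cast_natCast, h1]; ring⟩
    rw [Rat.isSquare_natCast_iff] at h2
    obtain ⟨r, hr⟩ := h2
    have := hsqf r ⟨1, by rw [hr, mul_one]⟩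
    rw [Nat.isUnit_iff] at this
    exact hgt (by rw [hr, this])
  have h1 := S.norm_lower hd α hI
  rw [hNα] at h1
  have h2 : m.prod ≤ x ^ T.card := by
    calc m.prod ≤ x ^ m.length := List.prod_le_pow_card _ _ fun p hp => (hT p (hmT p hp)).2.1
      _ ≤ x ^ T.card := Nat.pow_le_pow_right hx (by omega)
  have h3 : (m.prod : ℤ) ≤ (x : ℤ) ^ T.card := by exact_mod_cast h2
  linarith

end Heil

namespace Heil

open NumberField Ideal

variable {K : Type} [Field K] [NumberField K]

lemma norm_ne_zero' (x : 𝓞 K) (hx : x ≠ 0) : Algebra.norm ℤ x ≠ 0 := by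
  rwa [Ne, Algebra.norm_eq_zero_iff]

lemma ext_RI {d : ℤ} (S : QD d K) (x y : 𝓞 K) (hR : S.R x = S.R y) (hI : S.I x = S.I y) : x = y := by
  have e : x = (x - y) + y := by ring
  have h1 := S.R_add (x - y) y
  have h2 := S.I_add (x - y) y
  rw [← e] at h1 h2
  have h3 := S.norm_int (x - y)
  have h4 : S.R (x - y) = 0 := by linarith
  have h5 : S.I (x - y) = 0 := by linarith
  rw [h4, h5] at h3
  by_contra hne
  apply norm_ne_zero' (x - y) (sub_ne_zero.mpr hne)
  have : ((Algebra.norm ℤ (x - y) : ℤ) : ℚ) = 0 := by rw [h3]; ring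
  exact_mod_cast this

lemma finite_norm_elt {d : ℤ} (S : QD d K) (hd : d < 0) (n : ℤ) :
    {x : 𝓞 K | Algebra.norm ℤ x = n}.Finite := by
  choose u v huv using S.integral
  refine Set.Finite.of_finite_image (f := fun x => (u x, v x)) ?_ ?_
  · refine (Set.finite_Icc ((-(4 * n), -(4 * n)) : ℤ × ℤ) (4 * n, 4 * n)).subset ?_
    rintro _ ⟨x, hx, rfl⟩
    have h1 := S.norm_int x
    rw [Set.mem_ofPred_eq] at hx
    rw [hx] at h1
    have h2 : S.R x = u x / 2 := by rw [← (huv x).1]; simp [QD.R]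
    have h3 : S.I x = v x / 2 := by rw [← (huv x).2]; simp [QD.I]
    rw [h2, h3] at h1
    have h4 : (4 * n : ℚ) = (u x) ^ 2 - d * (v x) ^ 2 := by rw [h1]; ring
    have h5 : 4 * n = (u x) ^ 2 - d * (v x) ^ 2 := by exact_mod_cast h4
    have h6 : (v x) ^ 2 ≤ (-d) * (v x) ^ 2 := by nlinarith [sq_nonneg (v x)]
    have hu : (u x) ^ 2 ≤ 4 * n := by nlinarith [sq_nonneg (v x)]
    have hv : (v x) ^ 2 ≤ 4 * n := by nlinarith [sq_nonneg (u x)]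
    have key : ∀ a : ℤ, a ≤ a ^ 2 ∧ -a ≤ a ^ 2 := by
      intro a
      have := Int.le_self_sq a
      have := Int.le_self_sq (-a)
      constructor <;> nlinarith
    have := key (u x)
    have := key (v x)
    simp only [Set.mem_Icc, Prod.mk_le_mk]
    refine ⟨⟨?_, ?_⟩, ⟨?_, ?_⟩⟩ <;> linarith
  · intro x _ y _ hxy
    simp only [Prod.mk.injEq] at hxy
    apply ext_RI S
    · have h1 := (huv x).1
      have h2 := (huv y).1
      rw [hxy.1, ← h2] at h1
      exact mul_left_cancel₀ two_ne_zero h1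
    · have h1 := (huv x).2
      have h2 := (huv y).2
      rw [hxy.2, ← h2] at h1
      exact mul_left_cancel₀ two_ne_zero h1

lemma ideal_form {d : ℤ} (S : QD d K) (hd : d < 0) (J : Ideal (𝓞 K)) (hJ : J ≠ ⊥) :
    ∃ A B C : ℤ, 0 < A ∧ 0 < 4 * A * C - B ^ 2 ∧ ∃ φ : ℤ × ℤ ≃ J, ∀ p,
      Algebra.norm ℤ (φ p : 𝓞 K) = absNorm J * QF A B C p := by
  have hfr : Module.finrank ℤ (𝓞 K) = 2 := by rw [RingOfIntegers.rank, S.fr]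
  let b : Module.Basis (Fin 2) ℤ (𝓞 K) := Module.finBasisOfFinrankEq ℤ (𝓞 K) hfr
  let e := Ideal.selfBasis b J hJ
  let φ : ℤ × ℤ ≃ J := (finTwoArrowEquiv ℤ).symm.trans e.equivFun.symm.toEquiv
  have hφ : ∀ p, (φ p : 𝓞 K) = (p.1 : 𝓞 K) * (e 0 : 𝓞 K) + (p.2 : 𝓞 K) * (e 1 : 𝓞 K) := by
    intro p
    simp [φ, Module.Basis.equivFun_symm_apply, Fin.sum_univ_two]
  have hg0 : (absNorm J : ℤ) ≠ 0 := by
    exact_mod_cast (absNorm_ne_zero_iff_mem_nonZeroDivisors.mpr (mem_nonZeroDivisors_of_ne_zero hJ))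
  have hg : 0 < (absNorm J : ℤ) := by positivity
  have hdiv : ∀ x : J, ∃ A : ℤ, Algebra.norm ℤ (x : 𝓞 K) = absNorm J * A := fun x =>
    absNorm_dvd_norm_of_mem x.2
  obtain ⟨A, hA⟩ := hdiv (e 0)
  obtain ⟨C, hC⟩ := hdiv (e 1)
  obtain ⟨B', hB'⟩ := hdiv (e 0 + e 1)
  have hQ : ∀ p, Algebra.norm ℤ (φ p : 𝓞 K) = absNorm J * QF A (B' - A - C) C p := by
    intro p
    have h1 := S.norm_int (φ p)
    have h2 := S.norm_int (e 0)
    have h3 := S.norm_int (e 1)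
    have h4 := S.norm_int ((e 0 + e 1 : J) : 𝓞 K)
    rw [hφ] at h1
    rw [Submodule.coe_add] at h4
    simp only [S.R_add, S.I_add, S.R_mul, S.I_mul, S.R_int, S.I_int] at h1 h4
    rw [hA] at h2
    rw [hC] at h3
    rw [Submodule.coe_add] at hB'
    rw [hB'] at h4
    rw [hφ]
    have : ((Algebra.norm ℤ ((p.1 : 𝓞 K) * (e 0 : 𝓞 K) + (p.2 : 𝓞 K) * (e 1 : 𝓞 K)) : ℤ) : ℚ)
        = ((absNorm J * QF A (B' - A - C) C p : ℤ) : ℚ) := by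
      rw [h1]
      unfold QF
      push_cast at h2 h3 h4 ⊢
      linear_combination (-(p.1 : ℚ)^2 + p.1 * p.2) * h2 + (-(p.2:ℚ)^2 + p.1 * p.2) * h3 - (p.1 * p.2 : ℚ) * h4
    exact_mod_cast this
  have hpos : ∀ p : ℤ × ℤ, p ≠ 0 → 0 < QF A (B' - A - C) C p := by
    intro p hp
    have h0 : φ p ≠ 0 := by
      intro h
      apply hp
      apply φ.injective
      rw [h]
      apply Subtype.ext
      rw [hφ]; simp
    have h1 : Algebra.norm ℤ (φ p : 𝓞 K) ≠ 0 := norm_ne_zero' _ (by simpa using h0)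
    have h2 := S.norm_nonneg hd (φ p)
    have h3 : 0 < Algebra.norm ℤ (φ p : 𝓞 K) := lt_of_le_of_ne h2 h1.symm
    rw [hQ] at h3
    exact pos_of_mul_pos_right h3 hg.le
  have hA0 : 0 < A := by
    have := hpos (1, 0) (by simp)
    simpa [QF] using this
  refine ⟨A, B' - A - C, C, hA0, ?_, φ, hQ⟩
  have h1 := hpos (-(B' - A - C), 2 * A) (by simp [hA0.ne'])
  have h2 : QF A (B' - A - C) C (-(B' - A - C), 2 * A) = A * (4 * A * C - (B' - A - C) ^ 2) := by
    simp [QF]; ring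
  rw [h2] at h1
  exact pos_of_mul_pos_right h1 hA0.le

lemma card_form {d : ℤ} (S : QD d K) (hd : d < 0) (J : Ideal (𝓞 K)) (hJ : J ≠ ⊥) :
    ∃ A B C : ℤ, 0 < A ∧ 0 < 4 * A * C - B ^ 2 ∧ ∀ n : ℕ,
      Nat.card {x : 𝓞 K // x ∈ J ∧ Algebra.norm ℤ x = absNorm J * n} = RQ A B C n := by
  obtain ⟨A, B, C, hA, hD, φ, hφ⟩ := ideal_form S hd J hJ
  refine ⟨A, B, C, hA, hD, fun n => ?_⟩
  have hg0 : (absNorm J : ℤ) ≠ 0 := by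
    exact_mod_cast (absNorm_ne_zero_iff_mem_nonZeroDivisors.mpr (mem_nonZeroDivisors_of_ne_zero hJ))
  unfold RQ
  symm
  refine Nat.card_eq_of_bijective (fun p => ⟨φ p.1, (φ p.1).2, by rw [hφ, p.2]⟩) ⟨?_, ?_⟩
  · intro p p' h
    apply Subtype.ext
    apply φ.injective
    apply Subtype.ext
    simpa using h
  · rintro ⟨x, hx, hn⟩
    refine ⟨⟨φ.symm ⟨x, hx⟩, ?_⟩, ?_⟩
    · have := hφ (φ.symm ⟨x, hx⟩)
      rw [φ.apply_symm_apply] at this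
      simp only at this
      rw [hn] at this
      exact (mul_left_cancel₀ hg0 this).symm
    · simp

end Heil

namespace Heil

open NumberField Ideal

variable {K : Type} [Field K] [NumberField K]

lemma finite_units {d : ℤ} (S : QD d K) (hd : d < 0) : Finite (𝓞 K)ˣ := by
  have := (finite_norm_elt S hd 1).to_subtype
  refine Finite.of_injective (β := {x : 𝓞 K | Algebra.norm ℤ x = 1}) (fun u => ⟨(u : 𝓞 K), ?_⟩) ?_
  · have h1 : IsUnit (Algebra.norm ℤ (u : 𝓞 K)) := u.isUnit.map (Algebra.norm ℤ)
    have h2 := S.norm_nonneg hd (u : 𝓞 K)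
    rw [Int.isUnit_iff] at h1
    rw [Set.mem_ofPred_eq]
    rcases h1 with h | h
    · exact h
    · rw [h] at h2; norm_num at h2
  · intro u v h
    apply Units.ext
    simpa using h

lemma exists_inv_ideal (c : ClassGroup (𝓞 K)) : ∃ J : Ideal (𝓞 K), ∃ h : J ≠ 0,
    ClassGroup.mk0 ⟨J, mem_nonZeroDivisors_of_ne_zero h⟩ * c = 1 := by
  obtain ⟨⟨J, hJ⟩, h⟩ := ClassGroup.mk0_surjective c⁻¹
  exact ⟨J, nonZeroDivisors.ne_zero hJ, by rw [h]; simp⟩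

lemma class_sum {d : ℤ} (S : QD d K) (hd : d < 0) :
    ∃ A B C : ClassGroup (𝓞 K) → ℤ, (∀ c, 0 < A c ∧ 0 < 4 * A c * C c - B c ^ 2) ∧
      ∀ n : ℕ, n ≠ 0 → rI K n * Nat.card (𝓞 K)ˣ = ∑ c, RQ (A c) (B c) (C c) n := by
  classical
  choose J hJ0 hJ using exists_inv_ideal (K := K)
  choose A B C hA hD hcard using fun c => card_form S hd (J c) (hJ0 c)
  refine ⟨A, B, C, fun c => ⟨hA c, hD c⟩, fun n hn => ?_⟩
  simp_rw [← hcard]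
  have hfin : ∀ c, Finite {x : 𝓞 K // x ∈ J c ∧ Algebra.norm ℤ x = absNorm (J c) * n} := fun c =>
    ((finite_norm_elt S hd (absNorm (J c) * n)).subset fun x hx => hx.2).to_subtype
  have hfu := finite_units S hd
  rw [← Nat.card_sigma]
  unfold rI
  rw [← Nat.card_prod]
  have hI0 : ∀ I : {J : Ideal (𝓞 K) // absNorm J = n}, I.1 ≠ 0 := by
    rintro ⟨I, hI⟩ rfl
    rw [Ideal.zero_eq_bot, absNorm_bot] at hI
    exact hn hI.symm
  obtain ⟨cl, hcldef⟩ : ∃ cl : {J : Ideal (𝓞 K) // absNorm J = n} → ClassGroup (𝓞 K), ∀ I,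
    cl I = ClassGroup.mk0 ⟨I.1, mem_nonZeroDivisors_of_ne_zero (hI0 I)⟩ := ⟨_, fun I => rfl⟩
  have hgen : ∀ I : {J : Ideal (𝓞 K) // absNorm J = n}, ∃ α : 𝓞 K, J (cl I) * I.1 = span {α} := by
    intro I
    have h1 : ClassGroup.mk0 ⟨J (cl I), mem_nonZeroDivisors_of_ne_zero (hJ0 (cl I))⟩ *
        ClassGroup.mk0 ⟨I.1, mem_nonZeroDivisors_of_ne_zero (hI0 I)⟩ = 1 := by
      rw [← hcldef]; exact hJ (cl I)
    rw [← _root_.map_mul, ClassGroup.mk0_eq_one_iff] at h1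
    obtain ⟨α, hα⟩ := h1.principal
    exact ⟨α, hα⟩
  choose g hg using hgen
  have hspanu : ∀ I (u : (𝓞 K)ˣ), span {(u : 𝓞 K) * g I} = J (cl I) * I.1 := by
    intro I u
    rw [hg, span_singleton_mul_left_unit u.isUnit]
  have hnorm : ∀ I (u : (𝓞 K)ˣ), Algebra.norm ℤ ((u : 𝓞 K) * g I) = absNorm (J (cl I)) * n := by
    intro I u
    have h1 := congrArg absNorm (hspanu I u)
    rw [absNorm_span_singleton, _root_.map_mul absNorm, I.2] at h1
    rw [← Int.natAbs_of_nonneg (S.norm_nonneg hd _), h1]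
    push_cast; rfl
  have hmem : ∀ I (u : (𝓞 K)ˣ), (u : 𝓞 K) * g I ∈ J (cl I) := by
    intro I u
    have h1 : J (cl I) * I.1 ≤ J (cl I) := Ideal.mul_le_left
    rw [← hspanu I u] at h1
    exact (span_singleton_le_iff_mem (J (cl I))).mp h1
  refine Nat.card_eq_of_bijective (fun x => (⟨cl x.1, ⟨(x.2 : 𝓞 K) * g x.1, hmem x.1 x.2, hnorm x.1 x.2⟩⟩ :
    Σ c, {x : 𝓞 K // x ∈ J c ∧ Algebra.norm ℤ x = absNorm (J c) * n})) ⟨?_, ?_⟩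
  · rintro ⟨I, u⟩ ⟨I', u'⟩ h
    have hc : cl I = cl I' := congrArg (fun y => y.1) h
    have hv : (u : 𝓞 K) * g I = u' * g I' := congrArg (fun y => y.2.1) h
    have h1 := hspanu I u
    rw [hv, hspanu, hc] at h1
    have h2 : I' = I := Subtype.ext (mul_left_cancel₀ (hJ0 _) h1)
    subst h2
    have h3 : g I' ≠ 0 := by
      intro h0
      have := hg I'
      rw [h0, span_singleton_eq_bot.mpr rfl] at this
      exact mul_ne_zero (hJ0 _) (hI0 I') this
    have h4 := Units.ext (mul_right_cancel₀ h3 hv)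
    rw [h4]
  · rintro ⟨c, α, hα, hαn⟩
    obtain ⟨I, hI⟩ := dvd_iff_le.mpr ((span_singleton_le_iff_mem (J c)).mpr hα)
    have hNI : absNorm I = n := by
      have h1 := congrArg absNorm hI
      rw [absNorm_span_singleton, _root_.map_mul absNorm, hαn, Int.natAbs_mul] at h1
      simp only [Int.natAbs_natCast] at h1
      have : absNorm (J c) ≠ 0 :=
        absNorm_ne_zero_iff_mem_nonZeroDivisors.mpr (mem_nonZeroDivisors_of_ne_zero (hJ0 c))
      exact (Nat.eq_of_mul_eq_mul_left (Nat.pos_of_ne_zero this) h1).symm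
    have hcl : cl ⟨I, hNI⟩ = c := by
      have h1 := hJ c
      have h2 : ClassGroup.mk0 ⟨J c, mem_nonZeroDivisors_of_ne_zero (hJ0 c)⟩ * cl ⟨I, hNI⟩ = 1 := by
        rw [hcldef, ← _root_.map_mul, ClassGroup.mk0_eq_one_iff]
        exact ⟨α, hI.symm⟩
      exact mul_left_cancel (h2.trans h1.symm)
    have h1 := hg ⟨I, hNI⟩
    rw [hcl, ← hI, span_singleton_eq_span_singleton] at h1
    obtain ⟨u, hu⟩ := h1.symm
    refine ⟨⟨⟨I, hNI⟩, u⟩, ?_⟩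
    subst hcl
    refine Sigma.ext rfl (heq_of_eq (Subtype.ext ?_))
    rw [mul_comm] at hu
    exact hu

lemma rI_sum {d : ℤ} (S : QD d K) (hd : d < 0) (q : ℕ) [NeZero q] (χ : DirichletCharacter ℂ q) :
    ∃ κ : ℂ, ∀ x : ℝ, 1 ≤ x → ‖(∑ k ∈ Finset.Icc 1 ⌊x⌋₊, χ k * rI K k) - κ * x‖ ≤
      (NumberField.classNumber K * (8 * q ^ 2 + 1)) * √x := by
  classical
  obtain ⟨A, B, C, hpos, hsum⟩ := class_sum S hd
  choose κ hκ using fun c => form_sum (A c) (B c) (C c) (hpos c).1 (hpos c).2 q χ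
  have hfu := finite_units S hd
  have hw : 1 ≤ Nat.card (𝓞 K)ˣ := Nat.card_pos
  set w := Nat.card (𝓞 K)ˣ with hwdef
  have hwc : (w : ℂ) ≠ 0 := by exact_mod_cast (by omega : w ≠ 0)
  refine ⟨(∑ c, κ c) / w, fun x hx => ?_⟩
  have h1 : (∑ k ∈ Finset.Icc 1 ⌊x⌋₊, χ k * rI K k) - (∑ c, κ c) / w * x =
      (∑ c, ((∑ k ∈ Finset.Icc 1 ⌊x⌋₊, χ k * RQ (A c) (B c) (C c) k) - κ c * x)) / w := by
    rw [Finset.sum_sub_distrib, sub_div, ← Finset.sum_mul, Finset.sum_comm]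
    generalize (∑ c, κ c) = κ'
    rw [Finset.sum_div]
    congr 1
    · refine Finset.sum_congr rfl fun k hk => ?_
      have hk0 : k ≠ 0 := by have := (Finset.mem_Icc.mp hk).1; omega
      rw [← Finset.mul_sum, mul_div_assoc]
      congr 1
      rw [eq_div_iff hwc]
      exact_mod_cast hsum k hk0
    · ring
  rw [h1, norm_div]
  have h2 : ‖∑ c, ((∑ k ∈ Finset.Icc 1 ⌊x⌋₊, χ k * RQ (A c) (B c) (C c) k) - κ c * x)‖ ≤
      (NumberField.classNumber K * (8 * q ^ 2 + 1)) * √x := by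
    refine (norm_sum_le _ _).trans ((Finset.sum_le_sum fun c _ => hκ c x hx).trans ?_)
    rw [Finset.sum_const, nsmul_eq_mul, NumberField.classNumber, Finset.card_univ, mul_assoc]
  refine (div_le_self (_root_.norm_nonneg _) ?_).trans h2
  simp only [Complex.norm_natCast]
  exact_mod_cast hw

end Heil

namespace Heil

open scoped Classical in
lemma field_data (h₀ : ℕ) (d : ℤ) (hd : d < 0) (hsq : Squarefree d)
    (h : ∀ (K : Type) [Field K] [NumberField K], Module.finrank ℚ K = 2 →
          (∃ α : K, α ^ 2 = (d : K)) → NumberField.classNumber K = h₀) :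
    ∃ r : ℕ → ℕ, (∀ n, Odd n → (r n : ℤ) = ∑ m ∈ n.divisors, jacobiSym d m) ∧
      (∀ n, Odd n → (∀ p, p.Prime → p ∣ n → r p = 0) → r n = if IsSquare n then 1 else 0) ∧
      (∀ (T : Finset ℕ) (x : ℕ), (∀ p ∈ T, p.Prime ∧ p ≤ x ∧ r p ≠ 0) → 1 ≤ x → h₀ ≤ T.card →
        -d ≤ 4 * (x : ℤ) ^ T.card) ∧
      (∀ (q : ℕ) [NeZero q] (χ : DirichletCharacter ℂ q), ∃ κ : ℂ, ∀ x : ℝ, 1 ≤ x →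
        ‖(∑ k ∈ Finset.Icc 1 ⌊x⌋₊, χ k * r k) - κ * x‖ ≤ (h₀ * (8 * q ^ 2 + 1)) * √x) := by
  haveI : Fact (d < 0) := ⟨hd⟩
  obtain ⟨S⟩ := exists_QD d hsq
  have hcl : NumberField.classNumber (QK d) = h₀ := by
    refine h (QK d) S.fr ⟨algebraMap _ _ S.θ, ?_⟩
    rw [← map_pow, S.θ_sq, map_intCast]
  refine ⟨rI (QK d), rI_odd S, rI_inert S, fun T x hT hx hc => few_primes S hd T x hT hx (hcl ▸ hc), ?_⟩
  intro q _ χ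
  rw [← hcl]
  exact rI_sum S hd q χ

lemma max_good (D : Set ℤ) (hD : D.Infinite) (hneg : ∀ d ∈ D, d < 0) (h₀ : ℕ) (r : ℤ → ℕ → ℕ)
    (hr : ∀ d ∈ D, ∀ (T : Finset ℕ) (x : ℕ), (∀ p ∈ T, p.Prime ∧ p ≤ x ∧ r d p ≠ 0) → 1 ≤ x →
        h₀ ≤ T.card → -d ≤ 4 * (x : ℤ) ^ T.card) :
    ∃ (T : Finset ℕ) (D' : Set ℤ), (∀ p ∈ T, p.Prime) ∧ D'.Infinite ∧ D' ⊆ D ∧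
      ∀ p, p.Prime → p ∉ T → {d ∈ D' | r d p ≠ 0}.Finite := by
  classical
  let good : Finset ℕ → Prop := fun T => (∀ p ∈ T, p.Prime) ∧ {d ∈ D | ∀ p ∈ T, r d p ≠ 0}.Infinite
  have hb : ∀ T, good T → T.card ≤ h₀ := by
    rintro T ⟨hp, hinf⟩
    by_contra hlt
    apply hinf
    refine (Set.finite_Icc (-(4 * ((T.sup id + 1 : ℕ) : ℤ) ^ T.card)) 0).subset ?_
    rintro d ⟨hdD, hdr⟩
    have := hr d hdD T (T.sup id + 1) (fun p hpT => ⟨hp p hpT, ?_, hdr p hpT⟩) (by omega) (by omega)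
    · exact ⟨by linarith, (hneg d hdD).le⟩
    · have : p ≤ T.sup id := Finset.le_sup (f := id) hpT
      omega
  have h0 : good ∅ := ⟨by simp, by simpa using hD⟩
  let A : Set ℕ := {k | ∃ T, good T ∧ T.card = k}
  have hA : A.Nonempty := ⟨0, ∅, h0, by simp⟩
  have hAb : BddAbove A := ⟨h₀, by rintro _ ⟨T, hT, rfl⟩; exact hb T hT⟩
  obtain ⟨T, hT, hTk⟩ := Nat.sSup_mem hA hAb
  refine ⟨T, {d ∈ D | ∀ p ∈ T, r d p ≠ 0}, hT.1, hT.2, fun d hd => hd.1, fun p hp hpT => ?_⟩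
  by_contra hinf
  have hg : good (insert p T) := by
    refine ⟨?_, ?_⟩
    · intro p' hp'
      rcases Finset.mem_insert.mp hp' with rfl | h
      · exact hp
      · exact hT.1 _ h
    · refine Set.Infinite.mono ?_ hinf
      rintro d ⟨⟨hd1, hd2⟩, hd3⟩
      refine ⟨hd1, fun p' hp' => ?_⟩
      rcases Finset.mem_insert.mp hp' with rfl | h
      · exact hd3
      · exact hd2 _ h
  have h1 := le_csSup hAb (show (insert p T).card ∈ A from ⟨_, hg, rfl⟩)
  rw [Finset.card_insert_of_notMem hpT] at h1
  omega

end Heil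

theorem heilbronn_bounded_class_number_implies_GRH
    (h : ∃ h₀ : ℕ, 0 < h₀ ∧ {d : ℤ | d < 0 ∧ Squarefree d ∧
        ∀ (K : Type) [Field K] [NumberField K], Module.finrank ℚ K = 2 →
          (∃ α : K, α ^ 2 = (d : K)) → NumberField.classNumber K = h₀}.Infinite) :
    ∀ (q : ℕ) [NeZero q] (χ : DirichletCharacter ℂ q), χ ^ 2 = 1 →
      ∀ s : ℂ, DirichletCharacter.LFunction χ s = 0 → 0 < s.re → s.re < 1 → s.re = 1 / 2 := by
  classical
  intro q _ χ hχ s hs hs0 hs1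
  by_contra hs2
  obtain ⟨h₀, -, hD⟩ := h
  set D := {d : ℤ | d < 0 ∧ Squarefree d ∧
        ∀ (K : Type) [Field K] [NumberField K], Module.finrank ℚ K = 2 →
          (∃ α : K, α ^ 2 = (d : K)) → NumberField.classNumber K = h₀} with hDdef
  have hdata : ∀ d : ℤ, ∃ r : ℕ → ℕ, d ∈ D → _ := fun d => by
    by_cases hd : d ∈ D
    · obtain ⟨r, hr⟩ := Heil.field_data h₀ d hd.1 hd.2.1 hd.2.2
      exact ⟨r, fun _ => hr⟩
    · exact ⟨0, fun h => absurd h hd⟩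
  choose r hr using hdata
  obtain ⟨T, D', hTp, hD'i, hD'D, hfin⟩ := Heil.max_good D hD (fun d hd => hd.1) h₀ r
    (fun d hd => (hr d hd).2.2.1)
  obtain ⟨q', hq', χ', ρ, hρ, hρ1, hρ2⟩ := Heil.reflect q χ hχ s hs hs0 hs1 hs2
  have hTprod : ∏ p ∈ T, p ≠ 0 := Finset.prod_ne_zero_iff.mpr fun p hp => (hTp p hp).ne_zero
  set M := q' * (2 * ∏ p ∈ T, p) with hM
  haveI : NeZero M := ⟨mul_ne_zero hq'.out (mul_ne_zero two_ne_zero hTprod)⟩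
  have hdvd : q' ∣ M := ⟨_, rfl⟩
  have hρM := Heil.changeLevel_zero hdvd χ' ρ (by rintro rfl; simp at hρ2) hρ
  set X := DirichletCharacter.changeLevel hdvd χ' with hX
  have hcop : ∀ n : ℕ, X n ≠ 0 → Nat.Coprime n M := by
    intro n hn
    rw [← ZMod.isUnit_iff_coprime]
    by_contra hu
    exact hn (X.map_nonunit hu)
  have hodd : ∀ n : ℕ, X n ≠ 0 → Odd n := fun n hn => by
    have h1 := (hcop n hn).coprime_dvd_right (show 2 ∣ M from ⟨q' * ∏ p ∈ T, p, by rw [hM]; ring⟩)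
    exact Nat.coprime_two_right.mp h1
  have hnT : ∀ n : ℕ, X n ≠ 0 → ∀ p, p.Prime → p ∣ n → p ∉ T := fun n hn p hp hpn hpT => by
    have h2 : p ∣ M := (Finset.dvd_prod_of_mem (fun p => p) hpT).trans ⟨q' * 2, by rw [hM]; ring⟩
    exact Nat.not_coprime_of_dvd_of_dvd hp.one_lt hpn h2 (hcop n hn)
  let e := hD'i.natEmbedding
  have heD : ∀ j, (e j : ℤ) ∈ D := fun j => hD'D (e j).2
  have hNZ : ∀ j, NeZero (4 * (e j : ℤ).natAbs) := fun j =>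
    ⟨mul_ne_zero (by norm_num) (Int.natAbs_ne_zero.mpr (heD j).1.ne)⟩
  choose ψ hψ using fun j => haveI := hNZ j; Heil.exists_jacChar (e j : ℤ)
  choose κ hκ using fun j => (hr _ (heD j)).2.2.2 M X
  refine Heil.core M X ρ hρM hρ1 hρ2 (h₀ * (8 * M ^ 2 + 1)) (fun j n => (r (e j) n : ℂ)) _ hNZ ψ κ
    ?_ hκ ?_
  · intro j n hn
    by_cases h0 : X n = 0
    · rw [h0]; simp
    · congr 1
      have h1 := (hr _ (heD j)).1 n (hodd n h0)
      have h2 : ((r (e j) n : ℤ) : ℂ) = ∑ m ∈ n.divisors, (jacobiSym (e j) m : ℂ) := by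
        rw [h1]; push_cast; rfl
      rw [Int.cast_natCast] at h2
      rw [h2]
      refine Finset.sum_congr rfl fun m hm => ?_
      exact (hψ j m ((hodd n h0).of_dvd_nat (Nat.dvd_of_mem_divisors hm))).symm
  · intro n hn
    by_cases h0 : X n = 0
    · refine Filter.Eventually.of_forall fun j => ?_
      simp [Heil.sqc, h0]
    · have h1 : ∀ᶠ j in Filter.atTop, ∀ p ∈ n.primeFactors, r (e j) p = 0 := by
        rw [Filter.eventually_all_finset]
        intro p hp
        have hp1 := Nat.prime_of_mem_primeFactors hp
        have hf := hfin p hp1 (hnT n h0 p hp1 (Nat.dvd_of_mem_primeFactors hp))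
        have hf2 : {j : ℕ | r (e j) p ≠ 0}.Finite := by
          refine Set.Finite.of_finite_image (f := fun j => (e j : ℤ)) (hf.subset ?_) ?_
          · rintro _ ⟨j, hj, rfl⟩
            exact ⟨(e j).2, hj⟩
          · intro a _ b _ hab
            exact e.injective (Subtype.ext hab)
        rw [← Nat.cofinite_eq_atTop]
        filter_upwards [hf2.compl_mem_cofinite] with j hj
        by_contra hne
        exact hj hne
      filter_upwards [h1] with j hj
      have h2 := (hr _ (heD j)).2.1 n (hodd n h0) (fun p hp hpn => hj p (Nat.mem_primeFactors.mpr ⟨hp, hpn, hn⟩))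
      rw [h2, Heil.sqc]
      split_ifs <;> simp
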